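/- arXiv:math/0602419 — 4 statements merged into one kernel-verified Lean document; each statement's English description precedes it below -/
import Mathlib

section
/- If the sphere S^h admits an open cover by sets none of which contains a pair of antipodal points, then at least h+2 sets are needed in the cover (Lyusternik–Schnirel'man theorem). -/
section CubicalGrid

variable {ι : Type*}

lemma sum_sum_eq_zero_of_symm [Fintype ι] (a : ι → ι → ZMod 2) (hsymm : ∀ i j, a i j = a j i)
    (hdiag : ∀ i, a i i = 0) : ∑ i, ∑ j, a i j = 0 := by
  rw [← Fintype.sum_prod_type']
  refine Finset.sum_involution (fun x _ => x.swap) ?_ ?_ (by simp) (by simp)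
  · rintro ⟨i, j⟩ -
    simp only [Prod.swap, hsymm j i, CharTwo.add_self_eq_zero]
  · rintro ⟨i, j⟩ - hne heq
    simp only [Prod.swap_prod_mk, Prod.mk.injEq] at heq
    obtain ⟨rfl, -⟩ := heq
    exact hne (hdiag _)

/-- `p` is a face of the cell `q`, where cells of the cubical grid on `ι → ℝ` are encoded by their
doubled barycentres `ι → ℤ`; odd coordinates are the directions in which a cell extends. -/
def IsFace (p q : ι → ℤ) : Prop := ∀ i, p i = q i ∨ Odd (q i) ∧ |p i - q i| ≤ 1

lemma IsFace.refl (q : ι → ℤ) : IsFace q q := fun _ => Or.inl rfl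

variable [DecidableEq ι]

lemma IsFace.of_add_single {p q : ι → ℤ} {i : ι} (hi : Odd (q i))
    (h : IsFace p (q + Pi.single i 1)) : IsFace p q := fun j => by
  have := h j
  by_cases hj : j = i
  · subst hj
    simp only [Pi.add_apply, Pi.single_eq_same] at this
    grind
  · simpa [hj] using this

lemma IsFace.of_sub_single {p q : ι → ℤ} {i : ι} (hi : Odd (q i))
    (h : IsFace p (q - Pi.single i 1)) : IsFace p q := fun j => by
  have := h j
  by_cases hj : j = i
  · subst hj
    simp only [Pi.sub_apply, Pi.single_eq_same] at this
    grind
  · simpa [hj] using this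

variable [Fintype ι]

/-- The sum of `f` over the neighbours of `q` in the directions whose coordinate satisfies `P`.
For `P = Odd` this is the mod 2 cellular coboundary, for `P = Even` the mod 2 boundary. -/
def neighborSum (P : ℤ → Prop) [DecidablePred P] (f : (ι → ℤ) → ZMod 2) (q : ι → ℤ) : ZMod 2 :=
  ∑ i, if P (q i) then f (q + Pi.single i 1) + f (q - Pi.single i 1) else 0

lemma neighborSum_neighborSum (P : ℤ → Prop) [DecidablePred P]
    (hadd : ∀ n, P n → ¬ P (n + 1)) (hsub : ∀ n, P n → ¬ P (n - 1))
    (f : (ι → ℤ) → ZMod 2) (q : ι → ℤ) : neighborSum P (neighborSum P f) q = 0 := by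
  have key : neighborSum P (neighborSum P f) q = ∑ i, ∑ j,
      if i ≠ j ∧ P (q i) ∧ P (q j) then
        f (q + Pi.single i 1 + Pi.single j 1) + f (q + Pi.single i 1 - Pi.single j 1)
          + (f (q - Pi.single i 1 + Pi.single j 1) + f (q - Pi.single i 1 - Pi.single j 1))
      else 0 := by
    unfold neighborSum
    refine Finset.sum_congr rfl fun i _ => ?_
    by_cases hi : P (q i)
    · rw [if_pos hi, ← Finset.sum_add_distrib]
      refine Finset.sum_congr rfl fun j _ => ?_
      by_cases hij : i = j
      · subst hij
        simp [hadd _ hi, hsub _ hi]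
      · by_cases hj : P (q j) <;> simp [hij, hi, hj, Ne.symm hij]
    · simp [hi]
  rw [key]
  refine sum_sum_eq_zero_of_symm _ (fun i j => ?_) (by simp)
  by_cases h : i ≠ j ∧ P (q i) ∧ P (q j)
  · rw [if_pos h, if_pos ⟨h.1.symm, h.2.2, h.2.1⟩, add_right_comm q, add_sub_right_comm q,
      ← sub_add_eq_add_sub q, sub_right_comm q]
    ring
  · rw [if_neg h, if_neg (fun h' => h ⟨h'.1.symm, h'.2.2, h'.2.1⟩)]

/-- The mod 2 cellular coboundary. -/
abbrev coboundary : ((ι → ℤ) → ZMod 2) → (ι → ℤ) → ZMod 2 := neighborSum Odd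

/-- The mod 2 cellular boundary. -/
abbrev boundary : ((ι → ℤ) → ZMod 2) → (ι → ℤ) → ZMod 2 := neighborSum Even

lemma coboundary_coboundary (f : (ι → ℤ) → ZMod 2) (q : ι → ℤ) :
    coboundary (coboundary f) q = 0 :=
  neighborSum_neighborSum _ (fun n h => by grind) (fun n h => by grind) f q

lemma boundary_boundary (f : (ι → ℤ) → ZMod 2) (q : ι → ℤ) :
    boundary (boundary f) q = 0 :=
  neighborSum_neighborSum _ (fun n h => by grind) (fun n h => by grind) f q

lemma neighborSum_add (P : ℤ → Prop) [DecidablePred P] (f g : (ι → ℤ) → ZMod 2) :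
    neighborSum P (f + g) = neighborSum P f + neighborSum P g := by
  ext q
  simp only [neighborSum, Pi.add_apply, ← Finset.sum_add_distrib]
  refine Finset.sum_congr rfl fun i _ => ?_
  split_ifs <;> ring

lemma boundary_comp_neg (c : (ι → ℤ) → ZMod 2) (p : ι → ℤ) :
    boundary (fun q => c (-q)) p = boundary c (-p) := by
  unfold boundary neighborSum
  refine Finset.sum_congr rfl fun i _ => ?_
  simp only [Pi.neg_apply, even_neg]
  split_ifs
  · rw [add_comm]; congr 2 <;> abel
  · rfl

lemma finite_support_boundary {c : (ι → ℤ) → ZMod 2} (hc : c.support.Finite) :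
    (boundary c).support.Finite := by
  refine ((Set.finite_iUnion fun i : ι =>
    (hc.image (· + Pi.single i 1)).union (hc.image (· - Pi.single i 1)))).subset fun p hp => ?_
  obtain ⟨i, -, hi⟩ := Finset.exists_ne_zero_of_sum_ne_zero hp
  refine Set.mem_iUnion.2 ⟨i, ?_⟩
  by_cases h : c (p - Pi.single i 1) = 0
  · right
    refine ⟨p + Pi.single i 1, fun h' => hi (by simp [h, h']), by simp⟩
  · left
    exact ⟨p - Pi.single i 1, h, by simp⟩

lemma finsum_coboundary_mul (f : (ι → ℤ) → ZMod 2) {c : (ι → ℤ) → ZMod 2}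
    (hc : c.support.Finite) :
    ∑ᶠ q, coboundary f q * c q = ∑ᶠ p, f p * boundary c p := by
  have hfin (g : (ι → ℤ) → ZMod 2) (e : (ι → ℤ) ≃ (ι → ℤ)) :
      (fun q => g q * c (e q)).support.Finite := by
    refine (hc.preimage e.injective.injOn).subset fun q hq => ?_
    exact right_ne_zero_of_mul hq
  have hplus (i : ι) :=
    hfin (fun q => if Even (q i) then f q else 0) (Equiv.addRight (Pi.single i 1))
  have hminus (i : ι) :=
    hfin (fun q => if Even (q i) then f q else 0) (Equiv.subRight (Pi.single i 1))
  have hplus' (i : ι) :=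
    hfin (fun q => if Odd (q i) then f (q + Pi.single i 1) else 0) (Equiv.refl _)
  have hminus' (i : ι) :=
    hfin (fun q => if Odd (q i) then f (q - Pi.single i 1) else 0) (Equiv.refl _)
  simp only [Equiv.coe_addRight, Equiv.subRight_apply] at hplus hminus
  simp only [Equiv.refl_apply] at hplus' hminus'
  have hl : ∀ q, coboundary f q * c q = ∑ i,
      ((if Odd (q i) then f (q + Pi.single i 1) else 0) * c q +
        (if Odd (q i) then f (q - Pi.single i 1) else 0) * c q) := fun q => by
    rw [coboundary, neighborSum, Finset.sum_mul]
    refine Finset.sum_congr rfl fun i _ => ?_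
    split_ifs <;> ring
  have hr : ∀ q, f q * boundary c q = ∑ i,
      ((if Even (q i) then f q else 0) * c (q + Pi.single i 1) +
        (if Even (q i) then f q else 0) * c (q - Pi.single i 1)) := fun q => by
    rw [boundary, neighborSum, Finset.mul_sum]
    refine Finset.sum_congr rfl fun i _ => ?_
    split_ifs <;> ring
  simp_rw [hl, hr]
  rw [finsum_sum_comm _ _ fun i _ => ((hplus' i).union (hminus' i)).subset
      (Function.support_add _ _),
    finsum_sum_comm _ _ fun i _ => ((hplus i).union (hminus i)).subset
      (Function.support_add _ _)]
  refine Finset.sum_congr rfl fun i _ => ?_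
  rw [finsum_add_distrib (hplus' i) (hminus' i), finsum_add_distrib (hplus i) (hminus i), add_comm]
  congr 1
  · rw [← finsum_comp_equiv (Equiv.addRight (Pi.single i (1 : ℤ)))]
    refine finsum_congr fun q => ?_
    have : Odd (q i + 1) ↔ Even (q i) := by grind
    simp [this]
  · rw [← finsum_comp_equiv (Equiv.subRight (Pi.single i (1 : ℤ)))]
    refine finsum_congr fun q => ?_
    have : Odd (q i - 1) ↔ Even (q i) := by grind
    simp [this]

/-- The cellular representative of the cup product of the classes of the double covers
determined by the sign functions `s 0, …, s (k - 1)`. -/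
def signCocycle (s : ℕ → (ι → ℤ) → ZMod 2) : ℕ → (ι → ℤ) → ZMod 2
  | 0 => 1
  | k + 1 => coboundary (s k * signCocycle s k)

lemma coboundary_signCocycle (s : ℕ → (ι → ℤ) → ZMod 2) (k : ℕ) (q : ι → ℤ) :
    coboundary (signCocycle s k) q = 0 := by
  cases k with
  | zero => simp [coboundary, neighborSum, signCocycle, CharTwo.add_self_eq_zero]
  | succ k => exact coboundary_coboundary _ _

lemma signCocycle_eq_zero (s : ℕ → (ι → ℤ) → ZMod 2) {k i : ℕ} (hi : i < k) {q : ι → ℤ}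
    (hconst : ∀ p, IsFace p q → s i p = s i q) : signCocycle s k q = 0 := by
  induction k generalizing q with
  | zero => omega
  | succ k ih =>
    rcases Nat.lt_succ_iff_lt_or_eq.1 hi with hik | rfl
    · refine Finset.sum_eq_zero fun j _ => ?_
      split_ifs with hj
      · have h₁ : signCocycle s k (q + Pi.single j 1) = 0 := ih hik fun p hp => by
          rw [hconst p (hp.of_add_single hj), hconst _ ((IsFace.refl _).of_add_single hj)]
        have h₂ : signCocycle s k (q - Pi.single j 1) = 0 := ih hik fun p hp => by
          rw [hconst p (hp.of_sub_single hj), hconst _ ((IsFace.refl _).of_sub_single hj)]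
        simp [h₁, h₂]
      · rfl
    · have : signCocycle s (i + 1) q = s i q * coboundary (signCocycle s i) q := by
        rw [signCocycle, coboundary, neighborSum, neighborSum, Finset.mul_sum]
        refine Finset.sum_congr rfl fun j _ => ?_
        split_ifs with hj
        · simp only [Pi.mul_apply]
          rw [hconst _ ((IsFace.refl _).of_add_single hj),
            hconst _ ((IsFace.refl _).of_sub_single hj)]
          ring
        · simp
      rw [this, coboundary_signCocycle, mul_zero]

lemma signCocycle_neg (s : ℕ → (ι → ℤ) → ZMod 2)
    (hs : ∀ k p, p ≠ 0 → s k (-p) = s k p + 1) (k : ℕ) {q : ι → ℤ}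
    (hq : ¬ IsFace 0 q) : signCocycle s k (-q) = signCocycle s k q := by
  induction k generalizing q with
  | zero => rfl
  | succ k ih =>
    rw [← add_zero (signCocycle s (k + 1) q), ← coboundary_signCocycle s k q, signCocycle,
      coboundary, neighborSum, neighborSum, neighborSum, ← Finset.sum_add_distrib]
    refine Finset.sum_congr rfl fun i _ => ?_
    simp only [Pi.neg_apply, odd_neg]
    split_ifs with hi
    · have h₁ : ¬ IsFace 0 (q + Pi.single i 1) := fun h => hq (h.of_add_single hi)
      have h₂ : ¬ IsFace 0 (q - Pi.single i 1) := fun h => hq (h.of_sub_single hi)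
      have e₁ : -q + Pi.single i 1 = -(q - Pi.single i 1) := by abel
      have e₂ : -q - Pi.single i 1 = -(q + Pi.single i 1) := by abel
      simp only [Pi.mul_apply]
      rw [e₁, e₂, ih h₁, ih h₂, hs k _ fun h => h₁ (h ▸ IsFace.refl _),
        hs k _ fun h => h₂ (h ▸ IsFace.refl _)]
      ring
    · simp

end CubicalGrid

section Hemisphere

variable {d : ℕ}

/-- The chain of top-dimensional cells of the cube `[-M, M] ^ k × 0`. -/
def cubeChain (M : ℤ) (k : ℕ) (p : Fin d → ℤ) : ZMod 2 :=
  if ∀ i : Fin d, ((i : ℕ) < k → Odd (p i) ∧ |p i| < M) ∧ (k ≤ i → p i = 0) then 1 else 0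

/-- The chain of top-dimensional cells of the half cube `[-M, M] ^ k × [0, M] × 0`. -/
def halfCubeChain (M : ℤ) (k : ℕ) (p : Fin d → ℤ) : ZMod 2 :=
  if ∀ i : Fin d, ((i : ℕ) < k → Odd (p i) ∧ |p i| < M) ∧
    ((i : ℕ) = k → Odd (p i) ∧ 0 < p i ∧ p i < M) ∧ (k < i → p i = 0) then 1 else 0

/-- The chain of `k`-cells of the upper half of the boundary of the cube
`[-M, M] ^ (k + 1) × 0`. -/
def hemisphereChain (M : ℤ) (k : ℕ) : (Fin d → ℤ) → ZMod 2 :=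
  boundary (halfCubeChain M k) + cubeChain M k

lemma finite_box (M : ℤ) : {p : Fin d → ℤ | ∀ i, |p i| ≤ M}.Finite := by
  refine (Set.finite_Icc (fun _ : Fin d => -M) fun _ => M).subset fun p hp => ?_
  exact ⟨fun i => (abs_le.1 (hp i)).1, fun i => (abs_le.1 (hp i)).2⟩

lemma finite_support_cubeChain {M : ℤ} (hM : 0 < M) (k : ℕ) :
    (cubeChain M k : (Fin d → ℤ) → ZMod 2).support.Finite := by
  refine (finite_box M).subset fun p hp i => ?_
  simp only [cubeChain, Function.mem_support, ne_eq, ite_eq_right_iff, Classical.not_imp] at hp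
  have := hp.1 i
  grind

lemma finite_support_halfCubeChain {M : ℤ} (hM : 0 < M) (k : ℕ) :
    (halfCubeChain M k : (Fin d → ℤ) → ZMod 2).support.Finite := by
  refine (finite_box M).subset fun p hp i => ?_
  simp only [halfCubeChain, Function.mem_support, ne_eq, ite_eq_right_iff,
    Classical.not_imp] at hp
  have := hp.1 i
  grind

lemma finite_support_hemisphereChain {M : ℤ} (hM : 0 < M) (k : ℕ) :
    (hemisphereChain M k : (Fin d → ℤ) → ZMod 2).support.Finite :=
  ((finite_support_boundary (finite_support_halfCubeChain hM k)).union
    (finite_support_cubeChain hM k)).subset (Function.support_add _ _)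

lemma cubeChain_neg (M : ℤ) (k : ℕ) (p : Fin d → ℤ) : cubeChain M k (-p) = cubeChain M k p := by
  simp [cubeChain]

lemma halfCubeChain_add_neg (M : ℤ) {k : ℕ} (hk : k < d) :
    (halfCubeChain M k + fun p => halfCubeChain M k (-p) : (Fin d → ℤ) → ZMod 2) =
      cubeChain M (k + 1) := by
  ext p
  have key (ε : ℤ) (hε : ε = 1 ∨ ε = -1) : halfCubeChain M k (ε • p) =
      if 0 < ε * p ⟨k, hk⟩ then cubeChain M (k + 1) p else 0 := by
    unfold halfCubeChain cubeChain
    rw [← ite_and]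
    refine if_congr ⟨fun h => ⟨(h ⟨k, hk⟩).2.1 rfl |>.2.1, fun i => ?_⟩, fun h i => ?_⟩ rfl rfl
    · have := h i
      rcases hε with rfl | rfl <;> simp only [Pi.smul_apply, smul_eq_mul] at this <;> grind
    · have := h.2 i
      have h0 := h.1
      rcases lt_trichotomy (i : ℕ) k with hi | hi | hi
      · rcases hε with rfl | rfl <;> simp only [Pi.smul_apply, smul_eq_mul] <;> grind
      · obtain rfl : i = ⟨k, hk⟩ := Fin.ext hi
        rcases hε with rfl | rfl <;> simp only [Pi.smul_apply, smul_eq_mul] <;> grind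
      · rcases hε with rfl | rfl <;> simp only [Pi.smul_apply, smul_eq_mul] <;> grind
  have h₁ := key 1 (Or.inl rfl)
  have h₂ := key (-1) (Or.inr rfl)
  rw [one_smul] at h₁
  rw [neg_smul, one_smul] at h₂
  rw [Pi.add_apply, h₁, h₂]
  rcases lt_trichotomy (p ⟨k, hk⟩) 0 with h | h | h
  · simp [h, h.le]
  · have : cubeChain M (k + 1) p = 0 := if_neg fun h' => by
      have := ((h' ⟨k, hk⟩).1 (Nat.lt_succ_self k)).1
      simp [h] at this
    simp [this]
  · simp [h, h.le]

lemma boundary_hemisphereChain_succ (M : ℤ) {k : ℕ} (hk : k < d) (p : Fin d → ℤ) :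
    boundary (hemisphereChain M (k + 1)) p =
      hemisphereChain M k p + hemisphereChain M k (-p) := by
  have h : neighborSum Even (neighborSum Even (halfCubeChain M (k + 1))) =
      (0 : (Fin d → ℤ) → ZMod 2) :=
    funext fun q => boundary_boundary _ q
  rw [hemisphereChain, boundary, neighborSum_add, h, zero_add, ← halfCubeChain_add_neg M hk,
    neighborSum_add, hemisphereChain, Pi.add_apply, Pi.add_apply, Pi.add_apply, cubeChain_neg,
    ← boundary_comp_neg, add_add_add_comm, CharTwo.add_self_eq_zero, add_zero]

/-- Hemisphere chains are supported on the boundary of the cube. -/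
lemma mem_boundary_of_hemisphereChain_ne_zero {M : ℤ} (hM : 0 < M) (hM' : Even M) {k : ℕ}
    (hk : k < d) {p : Fin d → ℤ} (hp : hemisphereChain M k p ≠ 0) :
    (∀ i, |p i| ≤ M) ∧ ∃ i, |p i| = M := by
  have hle : ∀ i, |p i| ≤ M := by
    by_contra! hcon
    obtain ⟨j, hj⟩ := hcon
    refine hp ?_
    have h₀ : cubeChain M k p = 0 := if_neg fun h => by have := h j; grind
    have h₁ (ε : ℤ) (hε : |ε| = 1) (i : Fin d) (hi : Even (p i)) :
        halfCubeChain M k (p + Pi.single i ε) = 0 := if_neg fun h => by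
      have := h j
      by_cases hij : j = i
      · subst hij
        simp only [Pi.add_apply, Pi.single_eq_same] at this
        grind
      · simp only [Pi.add_apply, Pi.single_eq_of_ne hij] at this
        grind
    rw [hemisphereChain, Pi.add_apply, h₀, add_zero]
    refine Finset.sum_eq_zero fun i _ => ?_
    split_ifs with hi
    · rw [h₁ 1 (by simp) i hi, sub_eq_add_neg, ← Pi.single_neg, h₁ (-1) (by simp) i hi, add_zero]
    · rfl
  refine ⟨hle, ?_⟩
  by_contra! hne
  have hlt : ∀ i, |p i| < M := fun i => lt_of_le_of_ne (hle i) (hne i)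
  refine hp ?_
  have hterm (i : Fin d) (hi : i ≠ ⟨k, hk⟩) : (if Even (p i) then
      halfCubeChain M k (p + Pi.single i 1) + halfCubeChain M k (p - Pi.single i 1) else 0) =
        0 := by
    split_ifs with he
    · suffices h : halfCubeChain M k (p + Pi.single i 1) = halfCubeChain M k (p - Pi.single i 1) by
        rw [h, CharTwo.add_self_eq_zero]
      refine if_congr (forall_congr' fun j => ?_) rfl rfl
      have hik : (i : ℕ) ≠ k := fun h => hi (Fin.ext h)
      by_cases hij : j = i
      · subst hij
        have := hlt j
        simp only [Pi.add_apply, Pi.sub_apply, Pi.single_eq_same]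
        grind
      · simp [hij]
    · rfl
  rw [hemisphereChain, Pi.add_apply, boundary, neighborSum,
    Finset.sum_eq_single ⟨k, hk⟩ (fun i _ hi => hterm i hi) (by simp)]
  have hklt := hlt ⟨k, hk⟩
  by_cases h0 : p ⟨k, hk⟩ = 0
  · have hplus : halfCubeChain M k (p + Pi.single ⟨k, hk⟩ 1) = cubeChain M k p := by
      refine if_congr (forall_congr' fun j => ?_) rfl rfl
      by_cases hj : j = ⟨k, hk⟩
      · subst hj
        simp only [Pi.add_apply, Pi.single_eq_same]
        grind
      · have hjk : (j : ℕ) ≠ k := fun h => hj (Fin.ext h)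
        simp only [Pi.add_apply, Pi.single_eq_of_ne hj]
        grind
    have hminus : halfCubeChain M k (p - Pi.single ⟨k, hk⟩ 1) = 0 := if_neg fun h => by
      have := (h ⟨k, hk⟩).2.1 rfl
      simp [h0] at this
    rw [hplus, hminus, add_zero, if_pos (by simp [h0]), CharTwo.add_self_eq_zero]
  · have hcube : cubeChain M k p = 0 := if_neg fun h => h0 ((h ⟨k, hk⟩).2 le_rfl)
    rw [hcube, add_zero]
    split_ifs with he
    · suffices h : halfCubeChain M k (p + Pi.single ⟨k, hk⟩ 1) =
          halfCubeChain M k (p - Pi.single ⟨k, hk⟩ 1) by rw [h, CharTwo.add_self_eq_zero]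
      refine if_congr (forall_congr' fun j => ?_) rfl rfl
      by_cases hj : j = ⟨k, hk⟩
      · subst hj
        simp only [Pi.add_apply, Pi.sub_apply, Pi.single_eq_same]
        grind
      · simp [hj]
    · rfl

theorem finsum_signCocycle_mul_hemisphereChain {M : ℤ} (hM : 0 < M) (hM' : Even M)
    (s : ℕ → (Fin d → ℤ) → ZMod 2) (hs : ∀ k p, p ≠ 0 → s k (-p) = s k p + 1) {k : ℕ}
    (hk : k < d) : ∑ᶠ p, signCocycle s k p * hemisphereChain M k p = 1 := by
  induction k with
  | zero =>
    have h₁ : ∑ᶠ p : Fin d → ℤ, boundary (halfCubeChain M 0) p = 0 := by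
      have := finsum_coboundary_mul 1 (finite_support_halfCubeChain (d := d) hM 0)
      simpa [show coboundary (1 : (Fin d → ℤ) → ZMod 2) = 0 from
        funext fun q => coboundary_signCocycle s 0 q] using this.symm
    have h₂ : ∑ᶠ p : Fin d → ℤ, cubeChain M 0 p = 1 := by
      rw [finsum_eq_single _ 0]
      · simp [cubeChain]
      · intro p hp
        refine if_neg fun h => hp (funext fun i => (h i).2 (Nat.zero_le _))
    simp only [signCocycle, Pi.one_apply, one_mul, hemisphereChain, Pi.add_apply]
    rw [finsum_add_distrib (finite_support_boundary (finite_support_halfCubeChain hM 0))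
      (finite_support_cubeChain hM 0), h₁, h₂, zero_add]
  | succ k ih =>
    have hfin := finite_support_hemisphereChain (d := d) hM k
    have hmul (g : (Fin d → ℤ) → ZMod 2) :
        (fun p => g p * hemisphereChain M k p).support.Finite :=
      hfin.subset fun p hp => right_ne_zero_of_mul hp
    have hmul' (g : (Fin d → ℤ) → ZMod 2) :
        (fun p => g p * hemisphereChain M k (-p)).support.Finite :=
      (hfin.preimage neg_injective.injOn).subset fun p hp => right_ne_zero_of_mul hp
    rw [signCocycle, finsum_coboundary_mul _ (finite_support_hemisphereChain hM _)]
    simp_rw [boundary_hemisphereChain_succ M (Nat.lt_of_succ_lt hk), mul_add]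
    rw [finsum_add_distrib (hmul _) (hmul' _), ← ih (Nat.lt_of_succ_lt hk),
      ← finsum_comp_equiv (Equiv.neg _) (f := fun p => (s k * signCocycle s k) p *
        hemisphereChain M k (-p)),
      ← finsum_add_distrib (hmul _)]
    · refine finsum_congr fun p => ?_
      simp only [Equiv.neg_apply, neg_neg, Pi.mul_apply]
      by_cases hp : hemisphereChain M k p = 0
      · simp [hp]
      · obtain ⟨-, i, hi⟩ := mem_boundary_of_hemisphereChain_ne_zero hM hM'
          (Nat.lt_of_succ_lt hk) hp
        have hface : ¬ IsFace 0 p := fun h => by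
          have := h i
          simp only [Pi.zero_apply] at this
          grind
        rw [signCocycle_neg s hs k hface, hs k p fun h => hface (h ▸ IsFace.refl _), add_mul,
          add_mul, one_mul, ← add_assoc, CharTwo.add_self_eq_zero, zero_add]
    · simp only [Equiv.neg_apply, neg_neg]
      exact hmul fun p => (s k * signCocycle s k) (-p)

end Hemisphere

section Signs

open Classical in
/-- A sign function on the lattice which is `1` on `A`, `0` on `-A`, and antipodal away from
the origin when `A` contains no antipodal pair. -/
noncomputable def latticeSign {d : ℕ} (A : Set (Fin d → ℤ)) (p : Fin d → ℤ) : ZMod 2 :=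
  if p ∈ A then 1 else if -p ∈ A then 0 else if 0 < toLex p then 1 else 0

lemma latticeSign_neg {d : ℕ} {A : Set (Fin d → ℤ)} (hA : ∀ p ∈ A, -p ∉ A) {p : Fin d → ℤ}
    (hp : p ≠ 0) : latticeSign A (-p) = latticeSign A p + 1 := by
  have hlex : 0 < toLex (-p) ↔ ¬ 0 < toLex p := by
    rw [toLex_neg, Left.neg_pos_iff]
    refine ⟨fun h => h.asymm, fun h => ?_⟩
    rcases lt_trichotomy (toLex p) 0 with h' | h' | h'
    · exact h'
    · exact absurd (toLex.injective h') hp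
    · exact absurd h' h
  have h11 : (1 : ZMod 2) + 1 = 0 := CharTwo.add_self_eq_zero 1
  have := hA p
  unfold latticeSign
  rw [neg_neg]
  split_ifs <;> simp_all

end Signs

/-- **Lyusternik–Schnirel'man theorem.** If the sphere `S^h` (the unit sphere in
`ℝ^{h+1}`) is covered by `n` sets, each open in the sphere, and none of them
contains a pair of antipodal points, then `n ≥ h + 2`. -/
theorem lyusternik_schnirelman (h n : ℕ)
    (U : Fin n → Set (EuclideanSpace ℝ (Fin (h + 1))))
    (hopen : ∀ i, ∃ V, IsOpen V ∧ U i = V ∩ Metric.sphere 0 1)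
    (hcover : (Metric.sphere (0 : EuclideanSpace ℝ (Fin (h + 1))) 1) ⊆ ⋃ i, U i)
    (hanti : ∀ i, ∀ x, x ∈ U i → -x ∉ U i) :
    n ≥ h + 2 := by
  by_contra! hn
  let π : (Fin (h + 1) → ℝ) → EuclideanSpace ℝ (Fin (h + 1)) := fun x =>
    ‖WithLp.toLp 2 x‖⁻¹ • WithLp.toLp 2 x
  have hπneg (x) : π (-x) = -π x := by simp [π]
  have hπmem {x} (hx : x ≠ 0) : π x ∈ Metric.sphere 0 1 := by
    simp [π, norm_smul, hx]
  have hπcont : ContinuousOn π {0}ᶜ := by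
    have hcont : Continuous fun x : Fin (h + 1) → ℝ => WithLp.toLp 2 x := by fun_prop
    exact (hcont.norm.continuousOn.inv₀ fun x hx => by simpa using hx).smul hcont.continuousOn
  let W : Fin n → Set (Fin (h + 1) → ℝ) := fun i => {0}ᶜ ∩ π ⁻¹' U i
  have hWopen (i) : IsOpen (W i) := by
    obtain ⟨V, hV, hUV⟩ := hopen i
    have : W i = {0}ᶜ ∩ π ⁻¹' V := by
      ext x
      simp only [W, hUV, Set.mem_inter_iff, Set.mem_preimage, Set.mem_compl_singleton_iff]
      exact ⟨fun hx => ⟨hx.1, hx.2.1⟩, fun hx => ⟨hx.1, hx.2, hπmem hx.1⟩⟩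
    rw [this]
    exact hπcont.isOpen_inter_preimage isOpen_compl_singleton hV
  have hWanti (i) {x} (hx : x ∈ W i) : -x ∉ W i := fun hx' =>
    hanti i _ hx.2 (by rw [← hπneg]; exact hx'.2)
  have hWcover : Metric.sphere (0 : Fin (h + 1) → ℝ) 1 ⊆ ⋃ i, W i := fun x hx => by
    have hx0 : x ≠ 0 := ne_zero_of_mem_unit_sphere ⟨x, hx⟩
    obtain ⟨i, hi⟩ := Set.mem_iUnion.1 (hcover (hπmem hx0))
    exact Set.mem_iUnion.2 ⟨i, hx0, hi⟩
  obtain ⟨δ, hδ, hball⟩ := lebesgue_number_lemma_of_metric (isCompact_sphere _ _) hWopen hWcover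
  obtain ⟨m, hm⟩ := exists_nat_one_div_lt hδ
  let M : ℤ := 2 * (m + 1)
  have hM : 0 < M := by positivity
  have hMR : (0 : ℝ) < M := by exact_mod_cast hM
  have hMδ : (M : ℝ)⁻¹ < δ := by
    refine lt_of_le_of_lt ?_ hm
    rw [one_div]
    gcongr
    simp only [M]
    push_cast
    nlinarith [(Nat.cast_nonneg m : (0 : ℝ) ≤ m)]
  let r : (Fin (h + 1) → ℤ) → Fin (h + 1) → ℝ := fun p i => (M : ℝ)⁻¹ * p i
  have hrneg (p) : r (-p) = - r p := by ext i; simp [r]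
  let A : ℕ → Set (Fin (h + 1) → ℤ) := fun k => {p | ∃ i : Fin n, (i : ℕ) = k ∧ r p ∈ W i}
  have hA (k) : ∀ p ∈ A k, -p ∉ A k := by
    rintro p ⟨i, rfl, hi⟩ ⟨j, hj, hj'⟩
    obtain rfl := Fin.ext hj
    exact hWanti _ hi (hrneg p ▸ hj')
  have hsum := finsum_signCocycle_mul_hemisphereChain hM (even_two_mul _)
    (fun k => latticeSign (A k)) (fun k p hp => latticeSign_neg (hA k) hp) (Nat.lt_succ_self h)
  obtain ⟨q, hq⟩ : ∃ q,
      signCocycle (fun k => latticeSign (A k)) h q * hemisphereChain M h q ≠ 0 := by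
    by_contra! hzero
    exact zero_ne_one ((finsum_eq_zero_of_forall_eq_zero hzero).symm.trans hsum)
  obtain ⟨hqle, i₀, hi₀⟩ := mem_boundary_of_hemisphereChain_ne_zero hM (even_two_mul _)
    (Nat.lt_succ_self h) (right_ne_zero_of_mul hq)
  have hcoord (p : Fin (h + 1) → ℤ) (i) : ‖r p i‖ = (M : ℝ)⁻¹ * (|p i| : ℤ) := by
    simp [r, abs_of_pos hMR]
  have hqs : r q ∈ Metric.sphere (0 : Fin (h + 1) → ℝ) 1 := by
    rw [mem_sphere_zero_iff_norm]
    refine le_antisymm ((pi_norm_le_iff_of_nonneg zero_le_one).2 fun i => ?_) ?_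
    · rw [hcoord, inv_mul_le_one₀ hMR]
      exact_mod_cast hqle i
    · refine le_trans ?_ (norm_le_pi_norm _ i₀)
      rw [hcoord, hi₀, inv_mul_cancel₀ hMR.ne']
  have hface {p} (hp : IsFace p q) : dist (r p) (r q) < δ := by
    refine (dist_pi_lt_iff hδ).2 fun i => lt_of_le_of_lt ?_ hMδ
    have h1 : |p i - q i| ≤ 1 := by
      rcases hp i with h | h
      · simp [h]
      · exact h.2
    rw [Real.dist_eq, ← mul_sub, abs_mul, abs_of_pos (inv_pos.2 hMR)]
    refine mul_le_of_le_one_right (inv_pos.2 hMR).le ?_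
    exact_mod_cast h1
  obtain ⟨i, hi⟩ := hball (r q) hqs
  obtain ⟨j, hj⟩ := hball (-r q) (by simpa using hqs)
  have hpos {p} (hp : IsFace p q) : p ∈ A i := ⟨i, rfl, hi (hface hp)⟩
  have hneg {p} (hp : IsFace p q) : -p ∈ A j :=
    ⟨j, rfl, hj (by rw [hrneg, Metric.mem_ball, dist_neg_neg]; exact hface hp)⟩
  have hsign {k : ℕ} (hk : k < h) {c : ZMod 2} (hc : ∀ p, IsFace p q → latticeSign (A k) p = c) :
      False :=
    left_ne_zero_of_mul hq (signCocycle_eq_zero _ hk fun p hp =>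
      (hc p hp).trans (hc q (IsFace.refl q)).symm)
  by_cases hih : (i : ℕ) < h
  · exact hsign hih (c := 1) fun p hp => if_pos (hpos hp)
  by_cases hjh : (j : ℕ) < h
  · refine hsign hjh (c := 0) fun p hp => ?_
    have hp' : p ∉ A j := fun hp' => hA j p hp' (hneg hp)
    rw [latticeSign, if_neg hp', if_pos (hneg hp)]
  obtain rfl : i = j := Fin.ext (by omega)
  exact hA i q (hpos (IsFace.refl q)) (hneg (IsFace.refl q))
end

section
/- The even-dimensional sphere S^{2k} can be covered by 2k+3 open sets, none containing a pair of antipodal points, such that every point of the sphere is contained in at most k+2 of the sets. -/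
open Classical in
theorem setOf_le_card_filter_mem {X ι : Type*} [Fintype ι] (V : ι → Set X) (m : ℕ) :
    {x | m ≤ (Finset.univ.filter fun i => x ∈ V i).card} =
      ⋃ S ∈ {S : Finset ι | m ≤ S.card}, ⋂ i ∈ S, V i := by
  ext x
  simp only [Set.mem_ofPred_eq, Set.mem_iUnion, Set.mem_iInter, exists_prop]
  constructor
  · intro h
    exact ⟨_, h, fun i hi => (Finset.mem_filter.1 hi).2⟩
  · rintro ⟨S, hS, h⟩
    exact hS.trans (Finset.card_le_card fun i hi =>
      Finset.mem_filter.2 ⟨Finset.mem_univ i, h i hi⟩)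

open Classical in
theorem isOpen_setOf_le_card_filter_mem {X ι : Type*} [TopologicalSpace X] [Fintype ι]
    {V : ι → Set X} (hV : ∀ i, IsOpen (V i)) (m : ℕ) :
    IsOpen {x | m ≤ (Finset.univ.filter fun i => x ∈ V i).card} := by
  rw [setOf_le_card_filter_mem]
  exact isOpen_biUnion fun S _ => isOpen_biInter_finset fun i _ => hV i

open Classical in
theorem isClosed_setOf_le_card_filter_mem {X ι : Type*} [TopologicalSpace X] [Fintype ι]
    {V : ι → Set X} (hV : ∀ i, IsClosed (V i)) (m : ℕ) :
    IsClosed {x | m ≤ (Finset.univ.filter fun i => x ∈ V i).card} := by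
  rw [setOf_le_card_filter_mem]
  exact (Set.toFinite _).isClosed_biUnion fun S _ => isClosed_biInter fun i _ => hV i

/-- The first barycentric-type coordinate is minus the sum of the Cartesian coordinates, the others
are the Cartesian coordinates, so that all of them sum to zero. -/
def simplexCoord {n : ℕ} (i : Fin (n + 1)) (x : EuclideanSpace ℝ (Fin n)) : ℝ :=
  (Fin.cons (-∑ j, x j) (fun j => x j) : Fin (n + 1) → ℝ) i

theorem continuous_simplexCoord {n : ℕ} (i : Fin (n + 1)) :
    Continuous (simplexCoord i : EuclideanSpace ℝ (Fin n) → ℝ) := by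
  unfold simplexCoord
  cases i using Fin.cases <;> simp only [Fin.cons_zero, Fin.cons_succ] <;> fun_prop

theorem simplexCoord_neg {n : ℕ} (i : Fin (n + 1)) (x : EuclideanSpace ℝ (Fin n)) :
    simplexCoord i (-x) = -simplexCoord i x := by
  unfold simplexCoord
  cases i using Fin.cases <;> simp

theorem exists_lt_simplexCoord {n : ℕ} {x : EuclideanSpace ℝ (Fin n)} (hx : ‖x‖ = 1) :
    ∃ i, 1 / ((n : ℝ) + 1) ^ 2 < simplexCoord i x := by
  by_contra! h
  set δ : ℝ := 1 / ((n : ℝ) + 1) ^ 2 with hδ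
  have h0 : -∑ j, x j ≤ δ := by simpa [simplexCoord] using h 0
  have hle (j : Fin n) : x j ≤ δ := by simpa [simplexCoord] using h j.succ
  have hδ0 : 0 < δ := by positivity
  have hge (j : Fin n) : -(n * δ) ≤ x j := by
    have h1 : ∑ i ∈ Finset.univ.erase j, x i ≤ ((n : ℝ) - 1) * δ := by
      have := Finset.sum_le_card_nsmul (Finset.univ.erase j) (fun i => x i) δ fun i _ => hle i
      rwa [Finset.card_erase_of_mem (Finset.mem_univ j), Finset.card_univ, Fintype.card_fin,
        nsmul_eq_mul, Nat.cast_sub (Fin.pos j), Nat.cast_one] at this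
    have h2 := Finset.add_sum_erase Finset.univ (fun i => x i) (Finset.mem_univ j)
    simp only at h2
    linarith
  have hsq (j : Fin n) : x j ^ 2 ≤ (n * δ) ^ 2 := by
    have hn : (1 : ℝ) ≤ n := by exact_mod_cast Fin.pos j
    exact sq_le_sq' (hge j) ((hle j).trans (le_mul_of_one_le_left hδ0.le hn))
  have hsum : (1 : ℝ) ≤ n * (n * δ) ^ 2 := by
    have h1 := EuclideanSpace.real_norm_sq_eq x
    have h2 := Finset.sum_le_card_nsmul Finset.univ (fun j => x j ^ 2) _ fun j _ => hsq j
    rw [hx] at h1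
    simp only [Finset.card_univ, Fintype.card_fin, nsmul_eq_mul] at h2
    linarith
  have hnn : (0 : ℝ) ≤ n := Nat.cast_nonneg n
  rw [hδ, mul_one_div, div_pow, mul_div_assoc', le_div_iff₀ (by positivity)] at hsum
  nlinarith [pow_nonneg hnn 2, pow_nonneg hnn 3, pow_nonneg hnn 4]

/-- The even-dimensional sphere `S^{2k}` (the unit sphere in `ℝ^{2k+1}`, `k ≥ 1`)
can be covered by `2k+3` open sets, none containing a pair of antipodal points,
such that every point of the sphere is in at most `k+2` of the sets. -/
theorem even_sphere_cover (k : ℕ) (hk : 1 ≤ k) :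
    ∃ U : Fin (2 * k + 3) → Set (EuclideanSpace ℝ (Fin (2 * k + 1))),
      (∀ i, ∃ V, IsOpen V ∧ U i = V ∩ Metric.sphere 0 1) ∧
      (Metric.sphere (0 : EuclideanSpace ℝ (Fin (2 * k + 1))) 1 ⊆ ⋃ i, U i) ∧
      (∀ i, ∀ x, x ∈ U i → -x ∉ U i) ∧
      (∀ x ∈ Metric.sphere (0 : EuclideanSpace ℝ (Fin (2 * k + 1))) 1,
        {i : Fin (2 * k + 3) | x ∈ U i}.ncard ≤ k + 2) := by
  classical
  let E := EuclideanSpace ℝ (Fin (2 * k + 1))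
  obtain ⟨δ, hδ, hcov⟩ : ∃ δ : ℝ, 0 < δ ∧ ∀ x : E, ‖x‖ = 1 → ∃ i, δ < simplexCoord i x :=
    ⟨_, by positivity, fun x hx => exists_lt_simplexCoord hx⟩
  let P : Fin (2 * k + 1 + 1) → Set E := fun i => {x | 0 < simplexCoord i x}
  let Q : Fin (2 * k + 1 + 1) → Set E := fun i => {x | δ ≤ simplexCoord i x}
  let N : Set E := {x | k + 2 ≤ (Finset.univ.filter fun i => x ∈ P i).card}
  let L : Set E := {x | k + 2 ≤ (Finset.univ.filter fun i => x ∈ Q i).card}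
  have hN : IsOpen N := isOpen_setOf_le_card_filter_mem
    (fun i => isOpen_lt continuous_const (continuous_simplexCoord i)) _
  have hL : IsClosed L := isClosed_setOf_le_card_filter_mem
    (fun i => isClosed_le continuous_const (continuous_simplexCoord i)) _
  have hLN : L ⊆ N := fun x hx => le_trans hx <| Finset.card_le_card <|
    Finset.monotone_filter_right _ fun i _ (hi : δ ≤ _) => hδ.trans_le hi
  let W : Fin (2 * k + 1 + 1) → Set E := fun i => {x | δ < simplexCoord i x} \ L
  let V : Fin (2 * k + 3) → Set E := Fin.cons N W
  have hV0 : V 0 = N := rfl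
  have hVs (i : Fin (2 * k + 1 + 1)) : V i.succ = W i := rfl
  refine ⟨fun i => V i ∩ Metric.sphere 0 1, fun i => ⟨V i, ?_, rfl⟩, ?_, ?_, ?_⟩
  · cases i using Fin.cases with
    | zero => exact hN
    | succ i => exact (isOpen_lt continuous_const (continuous_simplexCoord i)).sdiff hL
  · intro x hx
    rw [Set.mem_iUnion]
    by_cases hxL : x ∈ L
    · exact ⟨0, hLN hxL, hx⟩
    · obtain ⟨i, hi⟩ := hcov x (by simpa using hx)
      exact ⟨i.succ, ⟨hi, hxL⟩, hx⟩
  · rintro i x ⟨hx, -⟩ ⟨hnx, -⟩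
    cases i using Fin.cases with
    | zero =>
      have h1 : k + 2 ≤ (Finset.univ.filter fun i => x ∈ P i).card := hx
      have h2 : k + 2 ≤ (Finset.univ.filter fun i => -x ∈ P i).card := hnx
      have hd : Disjoint (Finset.univ.filter fun i => x ∈ P i)
          (Finset.univ.filter fun i => -x ∈ P i) := by
        refine Finset.disjoint_filter.2 fun i _ hi hi' => ?_
        have h3 : 0 < simplexCoord i x := hi
        have h4 : 0 < simplexCoord i (-x) := hi'
        rw [simplexCoord_neg] at h4
        linarith
      have h5 := Finset.card_le_univ
        ((Finset.univ.filter fun i => x ∈ P i) ∪ (Finset.univ.filter fun i => -x ∈ P i))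
      rw [Finset.card_union_of_disjoint hd, Fintype.card_fin] at h5
      omega
    | succ i =>
      have h3 : δ < simplexCoord i x := hx.1
      have h4 : δ < simplexCoord i (-x) := hnx.1
      rw [simplexCoord_neg] at h4
      linarith
  · intro x _
    change {i | x ∈ V i ∩ Metric.sphere 0 1}.ncard ≤ k + 2
    by_cases hxL : x ∈ L
    · have hsub : {i | x ∈ V i ∩ Metric.sphere 0 1} ⊆ {0} := by
        rintro i ⟨hi, -⟩
        cases i using Fin.cases with
        | zero => rfl
        | succ i => exact (hi.2 hxL).elim
      have := Set.ncard_le_ncard hsub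
      rw [Set.ncard_singleton] at this
      omega
    · have hlt : (Finset.univ.filter fun i => x ∈ Q i).card < k + 2 := not_le.1 hxL
      have hsub : {i | x ∈ V i ∩ Metric.sphere 0 1} ⊆
          ↑(insert 0 ((Finset.univ.filter fun i => x ∈ Q i).image Fin.succ)) := by
        rintro i ⟨hi, -⟩
        cases i using Fin.cases with
        | zero => simp
        | succ i =>
          have h3 : δ < simplexCoord i x := hi.1
          exact Finset.mem_insert_of_mem <| Finset.mem_image_of_mem _ <|
            Finset.mem_filter.2 ⟨Finset.mem_univ i, h3.le⟩
      have h1 := Set.ncard_le_ncard hsub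
      rw [Set.ncard_coe_finset] at h1
      have h2 := Finset.card_insert_le 0 ((Finset.univ.filter fun i => x ∈ Q i).image Fin.succ)
      have h3 := Finset.card_image_le (s := Finset.univ.filter fun i => x ∈ Q i) (f := Fin.succ)
      omega
end

section
/- For every k ≥ 2, there is no continuous Z/2-equivariant map from the sphere S^{2k-1} to the deleted square (deleted product) of the k-dimensional skeleton of the 2k-dimensional simplex, where Z/2 acts on the sphere antipodally and on the deleted square by swapping factors. -/
open Set

/-- The geometric realization of the deleted square `K²_δ` of the `d`-dimensional
skeleton `K` of the simplex on the vertex set `Fin m`: pairs of points of the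
standard simplex supported on two disjoint faces, each with at most `d + 1`
vertices. -/
def deletedSquare (m d : ℕ) : Set ((Fin m → ℝ) × (Fin m → ℝ)) :=
  {p | p.1 ∈ stdSimplex ℝ (Fin m) ∧ p.2 ∈ stdSimplex ℝ (Fin m) ∧
    Disjoint (Function.support p.1) (Function.support p.2) ∧
    (Function.support p.1).ncard ≤ d + 1 ∧ (Function.support p.2).ncard ≤ d + 1}

/-- Ordered simplicial chains mod 2: formal sums of lists of vertices. -/
abbrev ModTwoChain (E : Type*) := List E →₀ ZMod 2

namespace ModTwoChain

open Finsupp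

section Boundary

variable {E : Type*}

theorem map_mem_of_supported {M : Type*} [AddCommGroup M] [Module (ZMod 2) M]
    (L : ModTwoChain E →ₗ[ZMod 2] M) (P : Submodule (ZMod 2) M) {s : Set (List E)}
    (h : ∀ l ∈ s, L (single l 1) ∈ P) {c : ModTwoChain E}
    (hc : c ∈ supported (ZMod 2) (ZMod 2) s) : L c ∈ P := by
  rw [supported_eq_span_single] at hc
  have : Submodule.span (ZMod 2) ((fun i ↦ single i (1 : ZMod 2)) '' s) ≤ P.comap L := by
    rw [Submodule.span_le]
    rintro _ ⟨l, hl, rfl⟩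
    exact h l hl
  exact this hc

theorem map_eq_zero_of_supported {M : Type*} [AddCommGroup M] [Module (ZMod 2) M]
    (L : ModTwoChain E →ₗ[ZMod 2] M) {s : Set (List E)}
    (h : ∀ l ∈ s, L (single l 1) = 0) {c : ModTwoChain E}
    (hc : c ∈ supported (ZMod 2) (ZMod 2) s) : L c = 0 :=
  (Submodule.mem_bot (ZMod 2)).1
    (map_mem_of_supported L ⊥ (fun l hl ↦ (Submodule.mem_bot _).2 (h l hl)) hc)

theorem add_self (c : ModTwoChain E) : c + c = 0 := by
  rw [← two_smul (ZMod 2) c, show (2 : ZMod 2) = 0 from rfl, zero_smul]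

theorem hom_ext {M : Type*} [AddCommGroup M] [Module (ZMod 2) M]
    {f g : ModTwoChain E →ₗ[ZMod 2] M} (h : ∀ l, f (single l 1) = g (single l 1)) : f = g :=
  Finsupp.lhom_ext' fun l ↦ LinearMap.ext_ring (h l)

/-- The cone with apex `a`. -/
noncomputable def cone (a : E) : ModTwoChain E →ₗ[ZMod 2] ModTwoChain E :=
  lmapDomain (ZMod 2) (ZMod 2) (List.cons a)

@[simp] theorem cone_single (a : E) (l : List E) :
    cone a (single l 1) = single (a :: l) 1 := by
  simp [cone]

/-- The sum of the codimension one faces of a simplex; the empty simplex counts as a face. -/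
noncomputable def faces : List E → ModTwoChain E
  | [] => 0
  | a :: l => single l 1 + cone a (faces l)

/-- The (augmented) boundary operator. -/
noncomputable def boundary : ModTwoChain E →ₗ[ZMod 2] ModTwoChain E :=
  linearCombination (ZMod 2) faces

theorem boundary_single (l : List E) : boundary (single l 1) = faces l := by
  simp [boundary]

theorem boundary_nil : boundary (single ([] : List E) 1) = 0 := boundary_single _

theorem boundary_cone (a : E) (c : ModTwoChain E) :
    boundary (cone a c) = c + cone a (boundary c) := by
  have : boundary ∘ₗ cone a = LinearMap.id + cone a ∘ₗ boundary :=
    hom_ext fun l ↦ by simp [boundary_single, faces]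
  exact LinearMap.congr_fun this c

theorem boundary_boundary (c : ModTwoChain E) : boundary (boundary c) = 0 := by
  have : boundary ∘ₗ boundary = (0 : ModTwoChain E →ₗ[ZMod 2] ModTwoChain E) := by
    refine hom_ext fun l ↦ ?_
    simp only [LinearMap.comp_apply, LinearMap.zero_apply]
    induction l with
    | nil => simp [boundary_nil]
    | cons a l ih =>
      rw [← cone_single, boundary_cone, map_add, boundary_cone, ih, map_zero, add_zero, add_self]
  exact LinearMap.congr_fun this c

theorem boundary_single_mem (l : List E) :
    boundary (single l 1) ∈
      supported (ZMod 2) (ZMod 2) {m : List E | m.length + 1 = l.length ∧ m ⊆ l} := by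
  induction l with
  | nil => simp [boundary_nil]
  | cons a l ih =>
    rw [← cone_single, boundary_cone]
    refine add_mem (single_mem_supported _ _ (by simp)) ?_
    refine map_mem_of_supported (cone a) _ (fun m hm ↦ ?_) ih
    rw [cone_single]
    refine single_mem_supported _ _ ⟨by simp [← hm.1], ?_⟩
    exact List.cons_subset_cons a hm.2

/-- The cochain `l ↦ s (head of l) * φ l`. -/
noncomputable def mulHead (s : E → ZMod 2) (φ : ModTwoChain E →ₗ[ZMod 2] ZMod 2) :
    ModTwoChain E →ₗ[ZMod 2] ZMod 2 :=
  linearCombination (ZMod 2) fun l ↦ l.head?.elim 0 s * φ (single l 1)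

theorem mulHead_single (s : E → ZMod 2) (φ : ModTwoChain E →ₗ[ZMod 2] ZMod 2) (l : List E) :
    mulHead s φ (single l 1) = l.head?.elim 0 s * φ (single l 1) := by
  simp [mulHead]

/-- The iterated cup product of the coboundaries of the given `0`-cochains. -/
noncomputable def cup : List (E → ZMod 2) → ModTwoChain E →ₗ[ZMod 2] ZMod 2
  | [] => lapply [] ∘ₗ boundary
  | s :: S => mulHead s (cup S) ∘ₗ boundary

theorem cup_boundary (S : List (E → ZMod 2)) (c : ModTwoChain E) : cup S (boundary c) = 0 := by
  cases S <;> simp [cup, boundary_boundary]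

theorem cup_nil (S : List (E → ZMod 2)) : cup S (single [] 1) = 0 := by
  cases S <;> simp [cup, boundary_nil]

theorem cup_eq_zero_of_const {S : List (E → ZMod 2)} {s : E → ZMod 2} (hs : s ∈ S)
    {l : List E} {b : ZMod 2} (hl : ∀ x ∈ l, s x = b) : cup S (single l 1) = 0 := by
  induction S generalizing l with
  | nil => simp at hs
  | cons t S ih =>
    rcases List.mem_cons.1 hs with rfl | hs
    · have : (mulHead s (cup S) - b • cup S) (boundary (single l 1)) = 0 := by
        refine map_eq_zero_of_supported _ (fun m hm ↦ ?_) (boundary_single_mem l)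
        rcases m with _ | ⟨x, m⟩
        · simp [mulHead_single, cup_nil]
        · simp [mulHead_single, hl x (hm.2 List.mem_cons_self)]
      simpa [cup_boundary, cup] using this
    · rw [cup, LinearMap.comp_apply]
      refine map_eq_zero_of_supported _ (fun m hm ↦ ?_) (boundary_single_mem l)
      rw [mulHead_single, ih hs fun x hx ↦ hl x (hm.2 hx), mul_zero]

end Boundary

section Antipode

variable {E : Type*} [AddCommGroup E]

/-- The chain map induced by `x ↦ -x`. -/
noncomputable def antipode : ModTwoChain E →ₗ[ZMod 2] ModTwoChain E :=
  lmapDomain (ZMod 2) (ZMod 2) (List.map Neg.neg)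

@[simp] theorem antipode_single (l : List E) :
    antipode (single l 1) = single (l.map Neg.neg) 1 := by
  simp [antipode]

theorem antipode_cone (a : E) (c : ModTwoChain E) :
    antipode (cone a c) = cone (-a) (antipode c) := by
  have : antipode ∘ₗ cone a = cone (-a) ∘ₗ antipode := hom_ext fun l ↦ by simp
  exact LinearMap.congr_fun this c

theorem antipode_antipode (c : ModTwoChain E) : antipode (antipode c) = c := by
  have : antipode ∘ₗ antipode = (LinearMap.id : ModTwoChain E →ₗ[ZMod 2] ModTwoChain E) :=
    hom_ext fun l ↦ by simp
  exact LinearMap.congr_fun this c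

theorem boundary_antipode (c : ModTwoChain E) :
    boundary (antipode c) = antipode (boundary c) := by
  have : boundary ∘ₗ antipode = (antipode ∘ₗ boundary : ModTwoChain E →ₗ[ZMod 2] _) := by
    refine hom_ext fun l ↦ ?_
    simp only [LinearMap.comp_apply]
    induction l with
    | nil => simp [boundary_nil]
    | cons a l ih =>
      rw [← cone_single, antipode_cone, boundary_cone, boundary_cone, ih, map_add, antipode_cone]
  exact LinearMap.congr_fun this c

theorem mulHead_add_antipode {K : Set E} {s : E → ZMod 2} (hs : ∀ x ∈ K, s (-x) = s x + 1)
    {S : List (E → ZMod 2)}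
    (hS : ∀ l : List E, (∀ x ∈ l, x ∈ K) →
      cup S (antipode (single l 1)) = cup S (single l 1))
    {c : ModTwoChain E} (hc : c ∈ supported (ZMod 2) (ZMod 2) {l : List E | ∀ x ∈ l, x ∈ K}) :
    mulHead s (cup S) (c + antipode c) = cup S c := by
  have : (mulHead s (cup S) ∘ₗ (LinearMap.id + antipode) - cup S :
      ModTwoChain E →ₗ[ZMod 2] ZMod 2) c = 0 := by
    refine map_eq_zero_of_supported _ (fun l hl ↦ ?_) hc
    have h := hS l hl
    rw [antipode_single] at h
    rcases l with _ | ⟨x, l⟩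
    · simp [mulHead_single, cup_nil]
    · simp only [LinearMap.sub_apply, LinearMap.comp_apply, LinearMap.add_apply,
        LinearMap.id_apply, map_add, antipode_single, mulHead_single, h]
      simp only [List.map_cons, List.head?_cons, Option.elim_some, hs x (hl x List.mem_cons_self)]
      rw [add_mul, ← add_assoc, ← add_mul, CharTwo.add_self_eq_zero]
      simp
  simpa [sub_eq_zero] using this

theorem cup_antipode {K : Set E} {S : List (E → ZMod 2)}
    (hS : ∀ s ∈ S, ∀ x ∈ K, s (-x) = s x + 1) (l : List E) (hl : ∀ x ∈ l, x ∈ K) :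
    cup S (antipode (single l 1)) = cup S (single l 1) := by
  induction S generalizing l with
  | nil =>
    have : lapply [] ∘ₗ antipode = (lapply [] : ModTwoChain E →ₗ[ZMod 2] ZMod 2) := by
      refine hom_ext fun l ↦ ?_
      cases l <;> simp
    simp only [cup, LinearMap.comp_apply, boundary_antipode]
    exact LinearMap.congr_fun this _
  | cons s S ih =>
    have hS' := fun t ht ↦ hS t (List.mem_cons_of_mem _ ht)
    have hb : boundary (single l 1) ∈
        supported (ZMod 2) (ZMod 2) {m : List E | ∀ x ∈ m, x ∈ K} :=
      supported_mono (fun m (hm : _ ∧ m ⊆ l) x hx ↦ hl x (hm.2 hx)) (boundary_single_mem l)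
    have := mulHead_add_antipode (hS s List.mem_cons_self) (fun l ↦ ih hS' l) hb
    rw [cup_boundary, map_add] at this
    simp only [cup, LinearMap.comp_apply, boundary_antipode]
    exact (CharTwo.add_eq_zero.1 this).symm

/-- The fundamental chain of the boundary of the cross-polytope with vertices `± v`. -/
noncomputable def crossPolytope : List E → ModTwoChain E
  | [] => single [] 1
  | v :: vs => cone v (crossPolytope vs) + antipode (cone v (crossPolytope vs))

theorem antipode_crossPolytope (vs : List E) :
    antipode (crossPolytope vs) = crossPolytope vs := by
  cases vs with
  | nil => simp [crossPolytope]
  | cons v vs => rw [crossPolytope, map_add, antipode_antipode, add_comm]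

theorem boundary_crossPolytope (vs : List E) : boundary (crossPolytope vs) = 0 := by
  induction vs with
  | nil => simp [crossPolytope, boundary_nil]
  | cons v vs ih =>
    rw [crossPolytope, map_add, boundary_antipode, boundary_cone, ih, map_zero, add_zero,
      antipode_crossPolytope, add_self]

end Antipode

section Subdivision

theorem sum_norm_sub_le {E : Type*} [NormedAddCommGroup E] {l : List E} {v : E}
    (hv : v ∈ l) {d : ℝ} (h : ∀ x ∈ l, ‖x - v‖ ≤ d) :
    (l.map fun x ↦ ‖x - v‖).sum ≤ ((l.length : ℝ) - 1) * d := by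
  classical
  have hp := List.perm_cons_erase hv
  rw [(hp.map fun x ↦ ‖x - v‖).sum_eq, hp.length_eq]
  have : ((l.erase v).map fun x ↦ ‖x - v‖).sum ≤
      ((l.erase v).map fun x ↦ ‖x - v‖).length • d :=
    List.sum_le_card_nsmul _ _ (by
      simp only [List.mem_map, forall_exists_index, and_imp]
      rintro _ x hx rfl
      exact h x (List.mem_of_mem_erase hx))
  simpa using this

variable {E : Type*} [NormedAddCommGroup E] [NormedSpace ℝ E]

/-- The barycenter of a list of points. -/
noncomputable def barycenter (l : List E) : E := (l.length : ℝ)⁻¹ • l.sum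

/-- Barycentric subdivision of simplices with `n` vertices. -/
noncomputable def subdivide : ℕ → ModTwoChain E →ₗ[ZMod 2] ModTwoChain E
  | 0 => LinearMap.id
  | n + 1 => linearCombination (ZMod 2) fun l ↦
      cone (barycenter l) (subdivide n (boundary (single l 1)))

theorem subdivide_succ_single (n : ℕ) (l : List E) :
    subdivide (n + 1) (single l 1) =
      cone (barycenter l) (subdivide n (boundary (single l 1))) := by
  simp [subdivide]

theorem boundary_subdivide (n : ℕ) (c : ModTwoChain E) :
    boundary (subdivide (n + 1) c) = subdivide n (boundary c) := by
  have : boundary ∘ₗ subdivide (n + 1) =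
      (subdivide n ∘ₗ boundary : ModTwoChain E →ₗ[ZMod 2] _) := by
    refine hom_ext fun l ↦ ?_
    simp only [LinearMap.comp_apply, subdivide_succ_single, boundary_cone]
    suffices boundary (subdivide n (boundary (single l 1))) = 0 by simp [this]
    cases n with
    | zero => simp [subdivide, boundary_boundary]
    | succ n => rw [boundary_subdivide n, boundary_boundary, map_zero]
  exact LinearMap.congr_fun this c

theorem barycenter_map_neg (l : List E) : barycenter (l.map Neg.neg) = -barycenter l := by
  rw [barycenter, barycenter, ← smul_neg, List.length_map]
  congr 1
  exact (map_list_sum (negAddMonoidHom : E →+ E) l).symm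

theorem subdivide_antipode (n : ℕ) (c : ModTwoChain E) :
    subdivide n (antipode c) = antipode (subdivide n c) := by
  induction n generalizing c with
  | zero => rfl
  | succ n ih =>
    have : subdivide (n + 1) ∘ₗ antipode =
        (antipode ∘ₗ subdivide (n + 1) : ModTwoChain E →ₗ[ZMod 2] _) := by
      refine hom_ext fun l ↦ ?_
      simp only [LinearMap.comp_apply, antipode_single, subdivide_succ_single, antipode_cone,
        barycenter_map_neg, ← ih, ← boundary_antipode]
    exact LinearMap.congr_fun this c

theorem barycenter_mem {C : Set E} (hC : Convex ℝ C) {l : List E} (hl : l ≠ [])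
    (h : ∀ x ∈ l, x ∈ C) : barycenter l ∈ C := by
  have h0 : (l.length : ℝ) ≠ 0 := by simpa using hl
  have : barycenter l = ∑ i : Fin l.length, (l.length : ℝ)⁻¹ • l[i] := by
    rw [barycenter, ← Finset.smul_sum]
    congr 1
    exact (Fin.sum_univ_getElem l).symm
  rw [this]
  refine hC.sum_mem (fun i _ ↦ by positivity) ?_ fun i _ ↦ h _ (by simp)
  simp [h0]

theorem dist_barycenter_le {l : List E} {v : E} (hv : v ∈ l) {d : ℝ}
    (h : ∀ x ∈ l, dist x v ≤ d) {N : ℕ} (hN : l.length ≤ N + 1) :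
    dist v (barycenter l) ≤ (N / (N + 1) : ℝ) * d := by
  have hd : 0 ≤ d := dist_nonneg.trans (h v hv)
  have hpos : (0 : ℝ) < l.length := by exact_mod_cast List.length_pos_of_mem hv
  have hN' : (l.length : ℝ) ≤ N + 1 := by exact_mod_cast hN
  have key : barycenter l - v = (l.length : ℝ)⁻¹ • (l.map fun x ↦ x - v).sum := by
    have : (l.map fun x ↦ x - v).sum = l.sum - (l.length : ℝ) • v := by
      clear hv h hpos hN hN'
      induction l with
      | nil => simp
      | cons a l ih =>
        simp only [List.map_cons, List.sum_cons, ih, List.length_cons]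
        push_cast
        module
    rw [this, smul_sub, inv_smul_smul₀ hpos.ne', barycenter]
  rw [dist_comm, dist_eq_norm, key, norm_smul, norm_inv, Real.norm_natCast]
  have h1 : ‖(l.map fun x ↦ x - v).sum‖ ≤ ((l.length : ℝ) - 1) * d := by
    refine le_trans (List.le_sum_of_subadditive norm norm_zero.le norm_add_le _) ?_
    rw [List.map_map]
    exact sum_norm_sub_le hv fun x hx ↦ by rw [← dist_eq_norm]; exact h x hx
  calc (l.length : ℝ)⁻¹ * ‖(l.map fun x ↦ x - v).sum‖
      ≤ (l.length : ℝ)⁻¹ * (((l.length : ℝ) - 1) * d) := by gcongr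
    _ = (((l.length : ℝ) - 1) / l.length) * d := by ring
    _ ≤ _ := by
      refine mul_le_mul_of_nonneg_right ?_ hd
      rw [div_le_div_iff₀ hpos (by positivity)]
      nlinarith

theorem subdivide_single_mem {N n : ℕ} (hn : n ≤ N + 1) {l : List E} (hl : l.length = n)
    {d : ℝ} (h : ∀ x ∈ l, ∀ y ∈ l, dist x y ≤ d) :
    subdivide n (single l 1) ∈ supported (ZMod 2) (ZMod 2)
      {m : List E | m.length = n ∧ (∀ x ∈ m, x ∈ convexHull ℝ {y | y ∈ l}) ∧
        ∀ x ∈ m, ∀ y ∈ m, dist x y ≤ (N / (N + 1) : ℝ) * d} := by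
  induction n generalizing l with
  | zero =>
    obtain rfl := List.length_eq_zero_iff.1 hl
    exact single_mem_supported _ _ (by simp)
  | succ n ih =>
    have hne : l ≠ [] := by rintro rfl; simp at hl
    have hconv : ∀ x ∈ l, x ∈ convexHull ℝ {y | y ∈ l} := fun x hx ↦ subset_convexHull ℝ _ hx
    have hb := barycenter_mem (convex_convexHull ℝ {y | y ∈ l}) hne hconv
    have hball : convexHull ℝ {y | y ∈ l} ⊆
        Metric.closedBall (barycenter l) ((N / (N + 1) : ℝ) * d) :=
      convexHull_min (fun x hx ↦ dist_barycenter_le hx (fun y hy ↦ h y hy x hx) (by omega))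
        (convex_closedBall _ _)
    rw [subdivide_succ_single]
    refine map_mem_of_supported (cone _ ∘ₗ subdivide n) _ (fun m hm ↦ ?_) (boundary_single_mem l)
    refine map_mem_of_supported (cone _) _ (fun m' hm' ↦ ?_)
      (ih (by omega) (by have := hm.1; omega)
        fun x hx y hy ↦ h x (hm.2 hx) y (hm.2 hy))
    have hsub : ∀ x ∈ m', x ∈ convexHull ℝ {y | y ∈ l} := fun x hx ↦
      convexHull_mono (fun y hy ↦ hm.2 hy) (hm'.2.1 x hx)
    rw [cone_single]
    refine single_mem_supported _ _ ⟨by simp [hm'.1], ?_, ?_⟩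
    · simpa [hb] using hsub
    · have h0 : dist (barycenter l) (barycenter l) ≤ (N / (N + 1) : ℝ) * d := hball hb
      intro x hx y hy
      rcases List.mem_cons.1 hx with rfl | hx <;> rcases List.mem_cons.1 hy with rfl | hy
      · exact h0
      · rw [dist_comm]; exact hball (hsub y hy)
      · exact hball (hsub x hx)
      · exact hm'.2.2 x hx y hy

/-- Simplices with `n` vertices in `K` (with their convex hull) and diameter at most `d`. -/
def smallSimplices (K : Set E) (n : ℕ) (d : ℝ) : Set (List E) :=
  {l | l.length = n ∧ convexHull ℝ {y | y ∈ l} ⊆ K ∧ ∀ x ∈ l, ∀ y ∈ l, dist x y ≤ d}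

theorem subdivide_mem {N n : ℕ} (hn : n ≤ N + 1) {K : Set E} {d : ℝ} {c : ModTwoChain E}
    (hc : c ∈ supported (ZMod 2) (ZMod 2) (smallSimplices K n d)) :
    subdivide n c ∈
      supported (ZMod 2) (ZMod 2) (smallSimplices K n ((N / (N + 1) : ℝ) * d)) := by
  refine map_mem_of_supported _ _ (fun l hl ↦ ?_) hc
  refine supported_mono ?_ (subdivide_single_mem hn hl.1 hl.2.2)
  exact fun m hm ↦ ⟨hm.1, (convexHull_min hm.2.1 (convex_convexHull ℝ _)).trans hl.2.1, hm.2.2⟩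

theorem iterate_subdivide_mem {N n : ℕ} (hn : n ≤ N + 1) {K : Set E} {d : ℝ}
    {c : ModTwoChain E} (hc : c ∈ supported (ZMod 2) (ZMod 2) (smallSimplices K n d)) (r : ℕ) :
    (subdivide n ^ r) c ∈
      supported (ZMod 2) (ZMod 2) (smallSimplices K n ((N / (N + 1) : ℝ) ^ r * d)) := by
  induction r with
  | zero => simpa using hc
  | succ r ih =>
    rw [pow_succ' (subdivide n), Module.End.mul_apply, pow_succ', mul_assoc]
    exact subdivide_mem hn ih

theorem boundary_iterate_subdivide (n r : ℕ) (c : ModTwoChain E) :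
    boundary ((subdivide (n + 1) ^ r) c) = (subdivide n ^ r) (boundary c) := by
  induction r with
  | zero => simp
  | succ r ih =>
    rw [pow_succ', Module.End.mul_apply, pow_succ', Module.End.mul_apply, boundary_subdivide, ih]

theorem iterate_subdivide_antipode (n r : ℕ) (c : ModTwoChain E) :
    (subdivide n ^ r) (antipode c) = antipode ((subdivide n ^ r) c) := by
  induction r with
  | zero => simp
  | succ r ih =>
    rw [pow_succ', Module.End.mul_apply, Module.End.mul_apply, ih, subdivide_antipode]

theorem cup_hemisphere {K : Set E} {S : List (E → ZMod 2)}
    (hS : ∀ s ∈ S, ∀ x ∈ K, s (-x) = s x + 1) (v : E) (vs : List E)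
    (hlen : vs.length = S.length) {d : ℝ}
    (hK : ∀ w ws, w :: ws <:+ v :: vs →
      cone w (crossPolytope ws) ∈
        supported (ZMod 2) (ZMod 2) (smallSimplices K (ws.length + 1) d)) (r : ℕ) :
    cup S ((subdivide (vs.length + 1) ^ r) (cone v (crossPolytope vs))) = 1 := by
  induction S generalizing v vs with
  | nil =>
    obtain rfl := List.length_eq_zero_iff.1 hlen
    have h1 : ∀ r c, (subdivide 0 ^ r) c = (c : ModTwoChain E) := fun r c ↦ by
      simp [subdivide, ← Module.End.one_eq_id]
    simp only [cup, LinearMap.comp_apply, List.length_nil]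
    rw [boundary_iterate_subdivide, h1, boundary_cone]
    simp [crossPolytope, boundary_nil]
  | cons s S ih =>
    rcases vs with _ | ⟨w, vs⟩
    · simp at hlen
    have hS' := fun t ht ↦ hS t (List.mem_cons_of_mem _ ht)
    simp only [cup, LinearMap.comp_apply, List.length_cons]
    rw [boundary_iterate_subdivide, boundary_cone, boundary_crossPolytope, map_zero, add_zero,
      crossPolytope, map_add, iterate_subdivide_antipode,
      mulHead_add_antipode (hS s List.mem_cons_self) (fun l ↦ cup_antipode hS' l)]
    · exact ih hS' w vs (by simpa using hlen)
        fun u us hu ↦ hK u us (hu.trans (List.suffix_cons _ _))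
    · refine supported_mono ?_ (iterate_subdivide_mem (N := vs.length) le_rfl
        (hK w vs (List.suffix_cons _ _)) r)
      exact fun l hl x hx ↦ hl.2.1 (subset_convexHull ℝ _ hx)

/-- A family of odd two-valued functions on the sphere of a cross-polytope jumps simultaneously
on arbitrarily small simplices. -/
theorem exists_small_simplex {K : Set E} {S : List (E → ZMod 2)}
    (hS : ∀ s ∈ S, ∀ x ∈ K, s (-x) = s x + 1) (v : E) (vs : List E)
    (hlen : vs.length = S.length) {d : ℝ}
    (hK : ∀ w ws, w :: ws <:+ v :: vs →
      cone w (crossPolytope ws) ∈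
        supported (ZMod 2) (ZMod 2) (smallSimplices K (ws.length + 1) d))
    {ε : ℝ} (hε : 0 < ε) :
    ∃ l ∈ smallSimplices K (vs.length + 1) ε, ∀ s ∈ S, ∃ x ∈ l, ∃ y ∈ l, s x ≠ s y := by
  obtain ⟨r, hr⟩ : ∃ r : ℕ, ((vs.length : ℝ) / (vs.length + 1)) ^ r * d < ε := by
    have := (tendsto_pow_atTop_nhds_zero_of_lt_one
      (r := (vs.length : ℝ) / (vs.length + 1)) (by positivity)
      (by rw [div_lt_one (by positivity)]; linarith)).mul_const d
    rw [zero_mul] at this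
    exact (this.eventually_lt_const hε).exists
  by_contra! hcon
  have h1 := cup_hemisphere hS v vs hlen hK r
  rw [map_eq_zero_of_supported (cup S) (fun l hl ↦ ?_)
    (iterate_subdivide_mem (N := vs.length) le_rfl (hK v vs List.suffix_rfl) r)] at h1
  · exact zero_ne_one h1
  · obtain ⟨s, hs, hconst⟩ := hcon l ⟨hl.1, hl.2.1, fun x hx y hy ↦ (hl.2.2 x hx y hy).trans hr.le⟩
    rcases l with _ | ⟨a, l⟩
    · exact cup_nil S
    · exact cup_eq_zero_of_const hs fun x hx ↦ hconst x hx a List.mem_cons_self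

end Subdivision

end ModTwoChain

section BorsukUlam

open Finsupp ModTwoChain

/-- The boundary of the cross-polytope. -/
def crossSphere (m : ℕ) : Set (EuclideanSpace ℝ (Fin m)) := {x | ∑ i, |x i| = 1}

/-- The facet of the cross-polytope in the orthant with signs `σ`. -/
def crossFacet {m : ℕ} (σ : Fin m → ℝ) : Set (EuclideanSpace ℝ (Fin m)) :=
  {x | (∀ i, 0 ≤ σ i * x i) ∧ ∑ i, σ i * x i = 1}

theorem convex_crossFacet {m : ℕ} (σ : Fin m → ℝ) : Convex ℝ (crossFacet σ) := by
  intro x hx y hy a b ha hb hab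
  refine ⟨fun i ↦ ?_, ?_⟩
  · have := add_nonneg (mul_nonneg ha (hx.1 i)) (mul_nonneg hb (hy.1 i))
    simp only [PiLp.add_apply, PiLp.smul_apply, smul_eq_mul]
    linarith
  · have : ∑ i, σ i * (a • x + b • y) i = a * ∑ i, σ i * x i + b * ∑ i, σ i * y i := by
      rw [Finset.mul_sum, Finset.mul_sum, ← Finset.sum_add_distrib]
      refine Finset.sum_congr rfl fun i _ ↦ ?_
      simp only [PiLp.add_apply, PiLp.smul_apply, smul_eq_mul]
      ring
    rw [this, hx.2, hy.2]
    linarith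

theorem crossFacet_subset {m : ℕ} {σ : Fin m → ℝ} (hσ : ∀ i, σ i = 1 ∨ σ i = -1) :
    crossFacet σ ⊆ crossSphere m := by
  rintro x ⟨h0, h1⟩
  refine (Finset.sum_congr rfl fun i _ ↦ ?_).trans h1
  have := h0 i
  rcases hσ i with h | h <;> rw [h] at this ⊢
  · rw [abs_of_nonneg (by linarith)]; ring
  · rw [abs_of_nonpos (by linarith)]; ring

/-- The simplices of the cross-polytope spanned by signed basis vectors with indices in `I`. -/
def signedSimplices {m : ℕ} (I : List (Fin m)) : Set (List (EuclideanSpace ℝ (Fin m))) :=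
  {l | l.length = I.length ∧ ∃ σ : Fin m → ℝ, (∀ i, σ i = 1 ∨ σ i = -1) ∧
    ∀ x ∈ l, ∃ i ∈ I, x = EuclideanSpace.single i (σ i)}

theorem signedSimplices_subset {m : ℕ} (I : List (Fin m)) :
    signedSimplices I ⊆ smallSimplices (crossSphere m) I.length 2 := by
  rintro l ⟨hl, σ, hσ, h⟩
  refine ⟨hl, (convexHull_min (fun x hx ↦ ?_) (convex_crossFacet σ)).trans
    (crossFacet_subset hσ), fun x hx y hy ↦ ?_⟩
  · obtain ⟨i, -, rfl⟩ := h x hx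
    have hsq : σ i * σ i = 1 := by rcases hσ i with h | h <;> rw [h] <;> norm_num
    refine ⟨fun j ↦ ?_, ?_⟩
    · by_cases hj : j = i
      · subst hj; simp [hsq]
      · simp [hj]
    · rw [Finset.sum_eq_single i] <;> simp +contextual [hsq]
  · have hn : ∀ z ∈ l, ‖z‖ ≤ 1 := by
      intro z hz
      obtain ⟨i, -, rfl⟩ := h z hz
      rcases hσ i with h | h <;> simp [h]
    rw [dist_eq_norm]
    linarith [norm_sub_le x y, hn x hx, hn y hy]

theorem cone_mem_signedSimplices {m : ℕ} {I : List (Fin m)} {i : Fin m} (hi : i ∉ I)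
    {c : ModTwoChain (EuclideanSpace ℝ (Fin m))}
    (hc : c ∈ supported (ZMod 2) (ZMod 2) (signedSimplices I)) :
    cone (EuclideanSpace.single i 1) c ∈
      supported (ZMod 2) (ZMod 2) (signedSimplices (i :: I)) := by
  refine map_mem_of_supported _ _ (fun l hl ↦ ?_) hc
  obtain ⟨hlen, σ, hσ, h⟩ := hl
  rw [cone_single]
  refine single_mem_supported _ _ ⟨by simp [hlen], Function.update σ i 1, fun j ↦ ?_, ?_⟩
  · by_cases hj : j = i
    · subst hj; simp
    · simpa [hj] using hσ j
  · rintro x hx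
    rcases List.mem_cons.1 hx with rfl | hx
    · exact ⟨i, by simp, by simp⟩
    · obtain ⟨j, hj, rfl⟩ := h x hx
      have : j ≠ i := fun h ↦ hi (h ▸ hj)
      exact ⟨j, by simp [hj], by simp [this]⟩

theorem antipode_mem_signedSimplices {m : ℕ} {I : List (Fin m)}
    {c : ModTwoChain (EuclideanSpace ℝ (Fin m))}
    (hc : c ∈ supported (ZMod 2) (ZMod 2) (signedSimplices I)) :
    antipode c ∈ supported (ZMod 2) (ZMod 2) (signedSimplices I) := by
  refine map_mem_of_supported _ _ (fun l hl ↦ ?_) hc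
  obtain ⟨hlen, σ, hσ, h⟩ := hl
  rw [antipode_single]
  refine single_mem_supported _ _ ⟨by simp [hlen], -σ, fun j ↦ ?_, ?_⟩
  · rcases hσ j with h | h <;> simp [h]
  · simp only [List.mem_map, forall_exists_index, and_imp]
    rintro _ x hx rfl
    obtain ⟨j, hj, rfl⟩ := h x hx
    exact ⟨j, hj, by ext k; by_cases hk : k = j <;> simp [hk]⟩

theorem crossPolytope_mem {m : ℕ} {I : List (Fin m)} (hI : I.Nodup) :
    crossPolytope (I.map fun i ↦ EuclideanSpace.single i (1 : ℝ)) ∈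
      supported (ZMod 2) (ZMod 2) (signedSimplices I) := by
  induction I with
  | nil => exact single_mem_supported _ _ ⟨rfl, 1, by simp, by simp⟩
  | cons i I ih =>
    have hI' := List.nodup_cons.1 hI
    have := cone_mem_signedSimplices hI'.1 (ih hI'.2)
    exact add_mem this (antipode_mem_signedSimplices this)

theorem isCompact_crossSphere (m : ℕ) : IsCompact (crossSphere m) := by
  refine Metric.isCompact_of_isClosed_isBounded ?_ ?_
  · exact isClosed_eq (by fun_prop) continuous_const
  · refine (Metric.isBounded_closedBall (x := 0) (r := 1)).subset fun x hx ↦ ?_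
    rw [mem_closedBall_zero_iff, EuclideanSpace.norm_eq, Real.sqrt_le_one]
    rw [← (show ∑ i, |x i| = 1 from hx)]
    refine Finset.sum_le_sum fun i _ ↦ ?_
    have h1 : |x i| ≤ 1 := by
      rw [← (show ∑ i, |x i| = 1 from hx)]
      exact Finset.single_le_sum (f := fun i ↦ |x i|) (fun _ _ ↦ abs_nonneg _) (Finset.mem_univ i)
    rw [Real.norm_eq_abs]
    nlinarith [abs_nonneg (x i)]

theorem ne_zero_of_mem_crossSphere {m : ℕ} {x : EuclideanSpace ℝ (Fin m)}
    (hx : x ∈ crossSphere m) : x ≠ 0 := by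
  rintro rfl
  simp [crossSphere] at hx

/-- The sign of a function, as an element of `ZMod 2`, with ties broken by a lexicographic order. -/
noncomputable def tieBreakSign {m : ℕ} (g : EuclideanSpace ℝ (Fin m) → ℝ)
    (x : EuclideanSpace ℝ (Fin m)) : ZMod 2 :=
  open Classical in if 0 < g x ∨ g x = 0 ∧ 0 < toLex (WithLp.ofLp x) then 1 else 0

theorem tieBreakSign_neg {m : ℕ} {g : EuclideanSpace ℝ (Fin m) → ℝ}
    {x : EuclideanSpace ℝ (Fin m)} (hx : x ≠ 0) (hg : g (-x) = -g x) :
    tieBreakSign g (-x) = tieBreakSign g x + 1 := by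
  have hne : toLex (WithLp.ofLp x) ≠ 0 := fun h ↦ hx (by simpa using h)
  have hlex : 0 < toLex (WithLp.ofLp (-x)) ↔ ¬ 0 < toLex (WithLp.ofLp x) := by
    rw [WithLp.ofLp_neg, toLex_neg, Left.neg_pos_iff]
    exact ⟨fun h h' ↦ lt_asymm h h', fun h ↦ (lt_or_gt_of_ne hne).resolve_right h⟩
  unfold tieBreakSign
  rw [hg, hlex]
  rcases lt_trichotomy (g x) 0 with h | h | h
  · simp [h, h.not_gt, h.ne]
  · by_cases h' : 0 < toLex (WithLp.ofLp x) <;> simp [h, h']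
    rfl
  · simp [h, h.not_gt, h.ne']
    rfl

theorem exists_sign_change {m : ℕ} {g : EuclideanSpace ℝ (Fin m) → ℝ}
    {x y : EuclideanSpace ℝ (Fin m)} (h : tieBreakSign g x ≠ tieBreakSign g y) :
    0 ≤ g x ∧ g y ≤ 0 ∨ 0 ≤ g y ∧ g x ≤ 0 := by
  by_contra! hcon
  apply h
  unfold tieBreakSign
  rcases lt_trichotomy (g x) 0 with hx | hx | hx <;>
    rcases lt_trichotomy (g y) 0 with hy | hy | hy <;>
    first
    | (simp [hx, hy, hx.not_gt, hy.not_gt, hx.ne, hy.ne]; done)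
    | grind

theorem exists_zero_of_odd_crossSphere {n : ℕ} (g : EuclideanSpace ℝ (Fin (n + 1)) → Fin n → ℝ)
    (hg : ContinuousOn g (crossSphere (n + 1)))
    (hodd : ∀ x ∈ crossSphere (n + 1), g (-x) = -g x) :
    ∃ x ∈ crossSphere (n + 1), g x = 0 := by
  by_contra! hne
  have hcpt := isCompact_crossSphere (n + 1)
  obtain ⟨δ, hδ, hmin⟩ : ∃ δ > 0, ∀ x ∈ crossSphere (n + 1), δ ≤ ‖g x‖ :=
    hcpt.exists_forall_le' hg.norm fun x hx ↦ norm_pos_iff.2 (hne x hx)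
  obtain ⟨η, hη, hunif⟩ := Metric.uniformContinuousOn_iff.1
    (hcpt.uniformContinuousOn_of_continuous hg) (δ / 2) (half_pos hδ)
  obtain ⟨v, vs, hvs⟩ : ∃ v vs, (List.finRange (n + 1)).map
      (fun i ↦ EuclideanSpace.single i (1 : ℝ)) = v :: vs := by
    rw [List.finRange_succ]
    exact ⟨_, _, rfl⟩
  have hlen : vs.length = n := by simpa using (congrArg List.length hvs).symm
  obtain ⟨l, hl, hsign⟩ := exists_small_simplex (K := crossSphere (n + 1))
    (S := (List.finRange n).map fun i ↦ tieBreakSign fun x ↦ g x i) (d := 2)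
    (by
      simp only [List.mem_map, forall_exists_index, and_imp]
      rintro _ i - rfl x hx
      exact tieBreakSign_neg (ne_zero_of_mem_crossSphere hx) (by rw [hodd x hx]; rfl))
    v vs (by simpa using hlen)
    (by
      intro w ws hw
      rw [← hvs] at hw
      obtain ⟨I, hI, hIw⟩ := List.suffix_map_iff.1 hw
      rcases I with _ | ⟨i, I⟩
      · simp at hIw
      · simp only [List.map_cons, List.cons.injEq] at hIw
        obtain ⟨rfl, rfl⟩ := hIw
        have hnd := List.nodup_cons.1 (hI.sublist.nodup (List.nodup_finRange _))
        have := supported_mono (signedSimplices_subset _)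
          (cone_mem_signedSimplices hnd.1 (crossPolytope_mem hnd.2))
        simpa using this)
    (half_pos hη)
  obtain ⟨a, ha⟩ : ∃ a, a ∈ l := List.exists_mem_of_length_pos (by rw [hl.1]; omega)
  have hK : ∀ x ∈ l, x ∈ crossSphere (n + 1) := fun x hx ↦ hl.2.1 (subset_convexHull ℝ _ hx)
  have hle : ‖g a‖ ≤ δ / 2 := by
    refine (pi_norm_le_iff_of_nonneg (half_pos hδ).le).2 fun i ↦ ?_
    have hclose : ∀ x ∈ l, |g x i - g a i| ≤ δ / 2 := fun x hx ↦ by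
      rw [← Real.dist_eq]
      exact (dist_le_pi_dist (g x) (g a) i).trans
        (hunif x (hK x hx) a (hK a ha) ((hl.2.2 x hx a ha).trans_lt (half_lt_self hη))).le
    obtain ⟨x, hx, y, hy, hxy⟩ := hsign _ (List.mem_map.2 ⟨i, List.mem_finRange i, rfl⟩)
    have h1 := abs_le.1 (hclose x hx)
    have h2 := abs_le.1 (hclose y hy)
    rw [Real.norm_eq_abs, abs_le]
    rcases exists_sign_change hxy with h | h <;> constructor <;> linarith
  linarith [hmin a (hK a ha)]

/-- The **Borsuk-Ulam theorem**: an odd continuous map from the unit sphere of `ℝⁿ⁺¹` to `ℝⁿ`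
vanishes somewhere. -/
theorem exists_zero_of_odd_sphere {n : ℕ} (f : EuclideanSpace ℝ (Fin (n + 1)) → Fin n → ℝ)
    (hf : ContinuousOn f (Metric.sphere 0 1))
    (hodd : ∀ x ∈ Metric.sphere (0 : EuclideanSpace ℝ (Fin (n + 1))) 1, f (-x) = -f x) :
    ∃ x ∈ Metric.sphere (0 : EuclideanSpace ℝ (Fin (n + 1))) 1, f x = 0 := by
  have hmaps : MapsTo (fun x : EuclideanSpace ℝ (Fin (n + 1)) ↦ ‖x‖⁻¹ • x)
      (crossSphere (n + 1)) (Metric.sphere 0 1) := fun x hx ↦ by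
    simpa using norm_smul_inv_norm (𝕜 := ℝ) (ne_zero_of_mem_crossSphere hx)
  obtain ⟨x, hx, h0⟩ := exists_zero_of_odd_crossSphere (fun x ↦ f (‖x‖⁻¹ • x))
    (hf.comp ((continuousOn_id.norm.inv₀ fun x hx ↦
      norm_ne_zero_iff.2 (ne_zero_of_mem_crossSphere hx)).smul continuousOn_id) hmaps)
    (fun x hx ↦ by
      rw [norm_neg, smul_neg]
      exact hodd _ (hmaps hx))
  exact ⟨_, hmaps hx, h0⟩

end BorsukUlam

/-- If `(x, y)` lies in a deleted square whose faces do not contain a facet of the simplex, then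
the coordinates of `x - y` other than the first are not all equal. -/
theorem not_forall_sub_eq_of_mem_deletedSquare {m d : ℕ} (hd : d + 1 < m)
    {p : (Fin (m + 1) → ℝ) × (Fin (m + 1) → ℝ)} (hp : p ∈ deletedSquare (m + 1) d) (c : ℝ) :
    ¬ ∀ j : Fin m, p.1 j.succ - p.2 j.succ = c := by
  intro h
  obtain ⟨h1, h2, hdisj, hc1, hc2⟩ := hp
  have hlarge : ∀ q : Fin (m + 1) → ℝ, (Function.support q).ncard ≤ d + 1 →
      ¬ ∀ j : Fin m, 0 < q j.succ := by
    intro q hq hpos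
    have hsub : range (Fin.succ : Fin m → Fin (m + 1)) ⊆ Function.support q := by
      rintro _ ⟨j, rfl⟩
      exact (hpos j).ne'
    have := ncard_le_ncard hsub (toFinite _)
    rw [← image_univ, ncard_image_of_injective _ (Fin.succ_injective m), ncard_univ,
      Nat.card_fin] at this
    omega
  rcases lt_trichotomy c 0 with hc | rfl | hc
  · exact hlarge p.2 hc2 fun j ↦ by linarith [h j, h1.1 j.succ]
  · have hz : ∀ j : Fin m, p.1 j.succ = 0 ∧ p.2 j.succ = 0 := fun j ↦ by
      have he := sub_eq_zero.1 (h j)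
      by_contra hne
      have hj : p.1 j.succ ≠ 0 := fun h0 ↦ hne ⟨h0, he ▸ h0⟩
      exact disjoint_left.1 hdisj hj (he ▸ hj : p.2 j.succ ≠ 0)
    have e1 := h1.2
    have e2 := h2.2
    simp only [Fin.sum_univ_succ, (hz _).1, (hz _).2, Finset.sum_const_zero, add_zero] at e1 e2
    have h0 : (0 : Fin (m + 1)) ∈ Function.support p.1 := by simp [e1]
    exact disjoint_left.1 hdisj h0 (by simp [e2])
  · exact hlarge p.1 hc1 fun j ↦ by linarith [h j, h2.1 j.succ]

/-- For every `k ≥ 2` there is no continuous `ℤ/2`-equivariant map from the sphere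
`S^{2k-1}` (unit sphere in `ℝ^{2k}`, with the antipodal action) to the deleted
square of the `k`-dimensional skeleton of the `2k`-dimensional simplex (with the
factor-swapping action). -/
theorem no_equivariant_map_to_deleted_square_odd (k : ℕ) (hk : 2 ≤ k) :
    ¬ ∃ F : EuclideanSpace ℝ (Fin (2 * k)) → (Fin (2 * k + 1) → ℝ) × (Fin (2 * k + 1) → ℝ),
      ContinuousOn F (Metric.sphere 0 1) ∧
      (∀ x ∈ Metric.sphere (0 : EuclideanSpace ℝ (Fin (2 * k))) 1,
        F x ∈ deletedSquare (2 * k + 1) k) ∧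
      (∀ x ∈ Metric.sphere (0 : EuclideanSpace ℝ (Fin (2 * k))) 1,
        F (-x) = Prod.swap (F x)) := by
  rintro ⟨F, hF, hmem, hodd⟩
  obtain ⟨n, hn⟩ : ∃ n, 2 * k = n + 1 := ⟨2 * k - 1, by omega⟩
  have hd : k + 1 < 2 * k := by omega
  generalize 2 * k = m at *
  subst hn
  obtain ⟨x, hx, h0⟩ := exists_zero_of_odd_sphere
    (fun x i ↦ ((F x).1 i.castSucc.succ - (F x).2 i.castSucc.succ) -
      ((F x).1 (Fin.last n).succ - (F x).2 (Fin.last n).succ))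
    (continuousOn_pi.2 fun i ↦ by
      have h1 : ∀ j, ContinuousOn (fun x ↦ (F x).1 j) (Metric.sphere 0 1) :=
        continuousOn_pi.1 hF.fst
      have h2 : ∀ j, ContinuousOn (fun x ↦ (F x).2 j) (Metric.sphere 0 1) :=
        continuousOn_pi.1 hF.snd
      exact ((h1 _).sub (h2 _)).sub ((h1 _).sub (h2 _)))
    (fun x hx ↦ by
      ext i
      simp only [hodd x hx, Prod.fst_swap, Prod.snd_swap, Pi.neg_apply]
      ring)
  refine not_forall_sub_eq_of_mem_deletedSquare hd (hmem x hx)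
    ((F x).1 (Fin.last n).succ - (F x).2 (Fin.last n).succ) fun j ↦ ?_
  induction j using Fin.lastCases with
  | last => rfl
  | cast i => exact sub_eq_zero.1 (congrFun h0 i)
end

section
/- For even h, the minimal l such that S^h can be covered by open sets, none containing a pair of antipodal points, with every point contained in at most l of the sets, equals h/2 + 2. -/
namespace AntipodalCover

/-- The mod 2 simplicial coboundary: the sum of the values of `f` on all lists obtained from
the argument by deleting one entry. -/
def coboundary {X : Type*} : (List X → ZMod 2) → List X → ZMod 2
  | _, [] => 0
  | f, x :: L => f L + coboundary (fun A => f (x :: A)) L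

/-- The sum of `G A B` over all ways to split a list into a front part `A` and a back part `B`
sharing exactly one entry (the Alexander–Whitney diagonal). -/
def splitSum {X : Type*} : (List X → List X → ZMod 2) → List X → ZMod 2
  | _, [] => 0
  | G, x :: L => G [x] (x :: L) + splitSum (fun A B => G (x :: A) B) L

section Cochains

variable {X Y : Type*}

lemma coboundary_congr {f g : List X → ZMod 2} {L : List X}
    (h : ∀ A, A.Sublist L → f A = g A) : coboundary f L = coboundary g L := by
  induction L generalizing f g with
  | nil => rfl
  | cons x L ih =>
    simp only [coboundary]
    rw [h L (List.sublist_cons_self x L), ih fun A hA => h _ (hA.cons_cons x)]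

lemma coboundary_zero (L : List X) : coboundary (fun _ => 0) L = 0 := by
  induction L with
  | nil => rfl
  | cons x L ih => simp [coboundary, ih]

lemma coboundary_add (f g : List X → ZMod 2) (L : List X) :
    coboundary (fun A => f A + g A) L = coboundary f L + coboundary g L := by
  induction L generalizing f g with
  | nil => simp [coboundary]
  | cons x L ih => simp only [coboundary, ih]; ring

lemma coboundary_map (f : List Y → ZMod 2) (h : X → Y) (L : List X) :
    coboundary (fun A => f (A.map h)) L = coboundary f (L.map h) := by
  induction L generalizing f with
  | nil => rfl
  | cons x L ih =>
    simp only [coboundary, List.map_cons]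
    rw [ih fun A => f (h x :: A)]

lemma coboundary_append (f : List X → ZMod 2) (A B : List X) :
    coboundary f (A ++ B) =
      coboundary (fun A' => f (A' ++ B)) A + coboundary (fun B' => f (A ++ B')) B := by
  induction A generalizing f with
  | nil => simp [coboundary]
  | cons x A ih => simp only [coboundary, List.cons_append, ih, add_assoc]

lemma coboundary_perm {f : List X → ZMod 2} (hf : ∀ A B, A.Perm B → f A = f B)
    {L M : List X} (h : L.Perm M) : coboundary f L = coboundary f M := by
  induction h generalizing f with
  | nil => rfl
  | cons x h ih =>
    simp only [coboundary]
    rw [hf _ _ h, ih fun A B hAB => hf _ _ (hAB.cons x)]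
  | swap x y L =>
    simp only [coboundary]
    have : (fun A => f (y :: x :: A)) = fun A => f (x :: y :: A) :=
      funext fun A => hf _ _ (List.Perm.swap x y A)
    rw [this]
    ring
  | trans _ _ ih₁ ih₂ => rw [ih₁ hf, ih₂ hf]

lemma coboundary_eq_zero_of_not_nodup {f : List X → ZMod 2}
    (hf : ∀ A B, A.Perm B → f A = f B) (hf₀ : ∀ A, ¬ A.Nodup → f A = 0)
    {L : List X} (hL : ¬ L.Nodup) : coboundary f L = 0 := by
  obtain ⟨x, hx⟩ := List.exists_duplicate_iff_not_nodup.2 hL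
  obtain ⟨M, hM⟩ := (List.duplicate_iff_sublist.1 hx).exists_perm_append
  have h₀ : (fun A => f (x :: x :: A)) = fun _ => 0 := funext fun A => hf₀ _ (by simp)
  rw [coboundary_perm hf hM]
  simp only [List.cons_append, List.nil_append, coboundary]
  rw [h₀, coboundary_zero, add_zero, CharTwo.add_self_eq_zero]

lemma splitSum_congr {G G' : List X → List X → ZMod 2} {M : List X}
    (h : ∀ A B, A.Sublist M → B.Sublist M → A.length + B.length = M.length + 1 → A ≠ [] →
      B ≠ [] → G A B = G' A B) : splitSum G M = splitSum G' M := by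
  induction M generalizing G G' with
  | nil => rfl
  | cons x L ih =>
    simp only [splitSum]
    congr 1
    · exact h _ _ (by simp) (List.Sublist.refl _) (by simp [add_comm]) (by simp) (by simp)
    · refine ih fun A B hA hB hl hA₀ hB₀ => h _ _ (hA.cons_cons x) (hB.cons x) ?_ (by simp) hB₀
      simp only [List.length_cons]
      omega

lemma splitSum_zero (M : List X) : splitSum (fun _ _ => 0) M = 0 := by
  induction M with
  | nil => rfl
  | cons x L ih => simp [splitSum, ih]

lemma splitSum_add (G G' : List X → List X → ZMod 2) (M : List X) :
    splitSum (fun A B => G A B + G' A B) M = splitSum G M + splitSum G' M := by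
  induction M generalizing G G' with
  | nil => rfl
  | cons x L ih => simp only [splitSum, ih]; ring

lemma splitSum_map (G : List Y → List Y → ZMod 2) (h : X → Y) (M : List X) :
    splitSum (fun A B => G (A.map h) (B.map h)) M = splitSum G (M.map h) := by
  induction M generalizing G with
  | nil => rfl
  | cons x L ih =>
    simp only [splitSum, List.map_cons]
    rw [← ih fun A B => G (h x :: A) B]
    rfl

lemma splitSum_concat (G : List X → List X → ZMod 2) (L : List X) (x : X) :
    splitSum G (L ++ [x]) = splitSum (fun A B => G A (B ++ [x])) L + G (L ++ [x]) [x] := by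
  induction L generalizing G with
  | nil => simp [splitSum]
  | cons y L ih => simp only [splitSum, List.cons_append, ih, add_assoc]

lemma splitSum_reverse (G : List X → List X → ZMod 2) (L : List X) :
    splitSum G L.reverse = splitSum (fun A B => G B.reverse A.reverse) L := by
  induction L generalizing G with
  | nil => rfl
  | cons x L ih =>
    simp only [List.reverse_cons, splitSum_concat, splitSum, ih, List.reverse_nil, List.nil_append]
    rw [add_comm]

lemma coboundary_splitSum (G : List X → List X → ZMod 2) (L : List X) :
    coboundary (splitSum G) L =
      splitSum (fun A B => coboundary (fun A' => G A' B) A + coboundary (G A) B) L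
        + G [] L + G L [] := by
  induction L generalizing G with
  | nil => simp [coboundary, splitSum, CharTwo.add_self_eq_zero]
  | cons x L ih =>
    have key : coboundary (fun A => splitSum G (x :: A)) L =
        coboundary (fun A => G [x] (x :: A)) L +
          coboundary (splitSum fun A B => G (x :: A) B) L := by
      rw [← coboundary_add]
      rfl
    simp only [coboundary]
    rw [key, ih]
    simp only [splitSum, coboundary]
    simp only [add_assoc, splitSum_add]
    have h2 : ∀ a : ZMod 2, a + a = 0 := CharTwo.add_self_eq_zero
    linear_combination -h2 (G [] (x :: L))

end Cochains

section Alternating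

/-- `alternating t cs` is `1` if the colours in `cs` alternate starting with `t`, else `0`. -/
def alternating : Bool → List Bool → ZMod 2
  | _, [] => 1
  | t, c :: cs => if c = t then alternating (!t) cs else 0

lemma coboundary_alternating (t : Bool) (cs : List Bool) :
    coboundary (alternating t) cs = alternating t cs + alternating (!t) cs := by
  induction cs generalizing t with
  | nil => simp [coboundary, alternating, CharTwo.add_self_eq_zero]
  | cons c cs ih =>
    simp only [coboundary, alternating]
    have h2 : ∀ a : ZMod 2, a + a = 0 := CharTwo.add_self_eq_zero
    by_cases h : c = t
    · have h' : ¬ c = !t := by simp [h]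
      simp only [h, if_true, ih, Bool.not_not]
      simp only [Bool.eq_not_self, if_false]
      linear_combination h2 (alternating t cs)
    · have h' : c = !t := by cases c <;> cases t <;> simp_all
      simp [h', coboundary_zero]

lemma alternating_map_not (t : Bool) (cs : List Bool) :
    alternating t (cs.map not) = alternating (!t) cs := by
  induction cs generalizing t with
  | nil => rfl
  | cons c cs ih =>
    simp only [alternating, List.map_cons, ih]
    cases c <;> cases t <;> simp

lemma alternating_replicate (t c : Bool) {r : ℕ} (hr : 2 ≤ r) :
    alternating t (List.replicate r c) = 0 := by
  obtain ⟨r, rfl⟩ := Nat.exists_eq_add_of_le' hr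
  simp only [List.replicate_succ, alternating]
  cases c <;> cases t <;> simp

variable {S : Type*} [LinearOrder S] (col : S → Bool)

/-- The value of `alternating` on the colours of the entries of a list sorted increasingly. -/
def sortedAlternating (t : Bool) (L : List S) : ZMod 2 :=
  alternating t ((L.insertionSort (· ≤ ·)).map col)

lemma sortedAlternating_perm (t : Bool) (A B : List S) (h : A.Perm B) :
    sortedAlternating col t A = sortedAlternating col t B := by
  have : A.insertionSort (· ≤ ·) = B.insertionSort (· ≤ ·) :=
    List.Perm.eq_of_pairwise' (r := (· ≤ ·)) (List.pairwise_insertionSort _ _)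
      (List.pairwise_insertionSort _ _)
      ((List.perm_insertionSort _ A).trans (h.trans (List.perm_insertionSort _ B).symm))
  rw [sortedAlternating, sortedAlternating, this]

lemma coboundary_sortedAlternating (t : Bool) (L : List S) :
    coboundary (sortedAlternating col t) L =
      sortedAlternating col t L + sortedAlternating col (!t) L := by
  rw [← coboundary_perm (sortedAlternating_perm col t) (List.perm_insertionSort (· ≤ ·) L),
    coboundary_congr (g := fun A => alternating t (A.map col)), coboundary_map,
    coboundary_alternating]
  · rfl
  · intro A hA
    rw [sortedAlternating, ((List.pairwise_insertionSort (· ≤ ·) L).sublist hA).insertionSort_eq]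

lemma pairwise_lt_of_alternating {t : Bool} {L : List S} (hL : L.Pairwise (· ≤ ·))
    (h : alternating t (L.map col) ≠ 0) : L.Pairwise (· < ·) := by
  rw [← List.isChain_iff_pairwise]
  induction L generalizing t with
  | nil => simp
  | cons a L ih =>
    rw [List.pairwise_cons] at hL
    simp only [List.map_cons, alternating] at h
    have ha : col a = t := by by_contra hc; simp [hc] at h
    rw [if_pos ha] at h
    have := ih hL.2 h
    cases L with
    | nil => simp
    | cons b L =>
      rw [List.isChain_cons_cons]
      refine ⟨lt_of_le_of_ne (hL.1 b (by simp)) ?_, this⟩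
      rintro rfl
      simp [alternating, ha] at h

lemma sortedAlternating_eq_zero_of_not_nodup (t : Bool) {L : List S} (hL : ¬ L.Nodup) :
    sortedAlternating col t L = 0 := by
  by_contra h
  have := pairwise_lt_of_alternating col (List.pairwise_insertionSort _ _) h
  exact hL ((List.perm_insertionSort _ L).nodup_iff.1 (this.imp fun h => h.ne))

lemma sortedAlternating_eq_zero_of_const (t c : Bool) {L : List S} (hL : 2 ≤ L.length)
    (hc : ∀ s ∈ L, col s = c) : sortedAlternating col t L = 0 := by
  have : (L.insertionSort (· ≤ ·)).map col = List.replicate L.length c := by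
    rw [List.eq_replicate_iff]
    refine ⟨by simp, fun b hb => ?_⟩
    obtain ⟨s, hs, rfl⟩ := List.mem_map.1 hb
    exact hc s ((List.perm_insertionSort _ L).mem_iff.1 hs)
  rw [sortedAlternating, this, alternating_replicate _ _ hL]

end Alternating

section Labels

variable {ι : Type*} [LinearOrder ι]

/-- The entry `a` with a sign attached; signed entries are ordered lexicographically. -/
def signed (c : Bool) (a : ι) : ι ×ₗ Bool := toLex (a, c)

/-- The sign of a signed entry. -/
def sign (a : ι ×ₗ Bool) : Bool := (ofLex a).2

/-- Reversal of the sign of a signed entry. -/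
def flipSign (a : ι ×ₗ Bool) : ι ×ₗ Bool := signed (!sign a) (ofLex a).1

/-- Indicator that the union of the positive copy of `A` and the negative copy of `B`
alternates in sign, starting with `t`. -/
def alternatingPair (t : Bool) (A B : List ι) : ZMod 2 :=
  sortedAlternating sign t (A.map (signed true) ++ B.map (signed false))

lemma alternatingPair_perm (t : Bool) {A A' B B' : List ι} (hA : A.Perm A') (hB : B.Perm B') :
    alternatingPair t A B = alternatingPair t A' B' :=
  sortedAlternating_perm _ _ _ _ ((hA.map _).append (hB.map _))

lemma alternatingPair_eq_zero_left (t : Bool) {A B : List ι} (h : ¬ A.Nodup) :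
    alternatingPair t A B = 0 :=
  sortedAlternating_eq_zero_of_not_nodup _ _ fun h' =>
    h (List.Nodup.of_map _ (List.nodup_append.1 h').1)

lemma alternatingPair_eq_zero_right (t : Bool) {A B : List ι} (h : ¬ B.Nodup) :
    alternatingPair t A B = 0 :=
  sortedAlternating_eq_zero_of_not_nodup _ _ fun h' =>
    h (List.Nodup.of_map _ (List.nodup_append.1 h').2.1)

lemma alternatingPair_nil_left (t : Bool) {B : List ι} (h : 2 ≤ B.length) :
    alternatingPair t [] B = 0 :=
  sortedAlternating_eq_zero_of_const _ _ false (by simpa using h) (by simp [sign, signed])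

lemma alternatingPair_nil_right (t : Bool) {A : List ι} (h : 2 ≤ A.length) :
    alternatingPair t A [] = 0 :=
  sortedAlternating_eq_zero_of_const _ _ true (by simpa using h) (by simp [sign, signed])

lemma coboundary_alternatingPair (t : Bool) (A B : List ι) :
    coboundary (fun A' => alternatingPair t A' B) A + coboundary (alternatingPair t A) B =
      alternatingPair t A B + alternatingPair (!t) A B := by
  have h := coboundary_sortedAlternating sign t (A.map (signed true) ++ B.map (signed false))
  rw [coboundary_append, ← coboundary_map, ← coboundary_map (h := signed false)] at h
  exact h

lemma alternatingPair_swap (t : Bool) {A B : List ι} (h : ∀ a ∈ A, ∀ b ∈ B, a ≠ b) :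
    alternatingPair t B A = alternatingPair (!t) A B := by
  have hp : (B.map (signed true) ++ A.map (signed false)).Perm
      ((A.map (signed true) ++ B.map (signed false)).map flipSign) := by
    have e₁ : flipSign ∘ signed (ι := ι) true = signed false := rfl
    have e₂ : flipSign ∘ signed (ι := ι) false = signed true := rfl
    rw [List.map_append, List.map_map, List.map_map, e₁, e₂]
    exact List.perm_append_comm
  rw [alternatingPair, sortedAlternating_perm _ _ _ _ hp, sortedAlternating,
    ← List.map_insertionSort (r := (· ≤ ·)), List.map_map,
    show sign (ι := ι) ∘ flipSign = not ∘ sign from rfl, ← List.map_map, alternating_map_not]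
  · rfl
  · intro x hx y hy
    have hxy : (ofLex x).1 = (ofLex y).1 → x = y := by
      simp only [List.mem_append, List.mem_map] at hx hy
      rcases hx with ⟨a, ha, rfl⟩ | ⟨a, ha, rfl⟩ <;> rcases hy with ⟨b, hb, rfl⟩ | ⟨b, hb, rfl⟩ <;>
        intro hab <;> simp only [signed, ofLex_toLex] at hab
      · rw [hab]
      · exact absurd hab (h _ ha _ hb)
      · exact absurd hab.symm (h _ hb _ ha)
      · rw [hab]
    rw [Prod.Lex.le_iff, Prod.Lex.le_iff]
    simp only [flipSign, signed, ofLex_toLex]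
    constructor
    · rintro (h₁ | ⟨h₁, -⟩)
      · exact Or.inl h₁
      · rw [hxy h₁]; simp
    · rintro (h₁ | ⟨h₁, -⟩)
      · exact Or.inl h₁
      · rw [hxy h₁]; simp

/-- The cochain on lists of pairs of labels pulled back from the alternation indicator. -/
def labelCochain (M : List (ι × ι)) : ZMod 2 :=
  splitSum (fun A B => alternatingPair true (A.map Prod.fst) (B.map Prod.snd)) M

lemma labelCochain_reverse {M : List (ι × ι)} (h : ∀ a ∈ M, ∀ b ∈ M, a.1 ≠ b.2) :
    labelCochain (M.map Prod.swap).reverse =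
      splitSum (fun A B => alternatingPair false (A.map Prod.fst) (B.map Prod.snd)) M := by
  rw [labelCochain, splitSum_reverse, ← splitSum_map]
  refine splitSum_congr fun A B hA hB _ _ _ => ?_
  rw [alternatingPair_perm true ((List.reverse_perm (B.map Prod.swap)).map _)
    ((List.reverse_perm (A.map Prod.swap)).map _), List.map_map, List.map_map]
  refine alternatingPair_swap true fun a' ha' b' hb' => ?_
  obtain ⟨a, ha, rfl⟩ : ∃ a ∈ A, a.1 = a' := by simpa using ha'
  obtain ⟨b, hb, rfl⟩ : ∃ b ∈ B, b.2 = b' := by simpa using hb'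
  exact h a (hA.subset ha) b (hB.subset hb)

lemma coboundary_labelCochain {M : List (ι × ι)} (h : ∀ a ∈ M, ∀ b ∈ M, a.1 ≠ b.2)
    (hM : 2 ≤ M.length) :
    coboundary labelCochain M = labelCochain M + labelCochain (M.map Prod.swap).reverse := by
  rw [labelCochain_reverse h]
  have := coboundary_splitSum
    (fun A B => alternatingPair true (A.map (Prod.fst (α := ι))) (B.map (Prod.snd (β := ι)))) M
  simp only [List.map_nil] at this
  rw [alternatingPair_nil_left _ (by simpa using hM),
    alternatingPair_nil_right _ (by simpa using hM), add_zero, add_zero] at this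
  refine this.trans ?_
  rw [labelCochain, ← splitSum_add]
  congr 1
  ext A B
  rw [coboundary_map (fun A' => alternatingPair true A' (B.map Prod.snd)),
    coboundary_map (fun B' => alternatingPair true (A.map Prod.fst) B')]
  exact coboundary_alternatingPair true _ _

lemma labelCochain_singleton {a : ι × ι} (h : a.1 ≠ a.2) :
    labelCochain [a] + labelCochain ([a].map Prod.swap).reverse = 1 := by
  rw [labelCochain_reverse (by simpa using h)]
  have := coboundary_alternatingPair true [a.1] [a.2]
  simp only [labelCochain, splitSum, List.map_cons, List.map_nil, add_zero]
  refine this.symm.trans ?_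
  simp [coboundary, alternatingPair, sortedAlternating, alternating, sign, signed]

lemma not_nodup_map_of_sublist {α β : Type*} [DecidableEq β] {f : α → β} {A M : List α} {r : ℕ}
    (hM : (M.map f).toFinset.card ≤ r) (hA : A.Sublist M) (hr : r < A.length) :
    ¬ (A.map f).Nodup := fun h => by
  have h₁ : (A.map f).toFinset.card ≤ (M.map f).toFinset.card := Finset.card_le_card fun x hx =>
    List.mem_toFinset.2 ((hA.map _).subset (List.mem_toFinset.1 hx))
  rw [List.toFinset_card_of_nodup h, List.length_map] at h₁
  omega

lemma not_nodup_map_of_const {α β : Type*} {f : α → β} {A : List α} (hA : 2 ≤ A.length) {c : β}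
    (hc : ∀ a ∈ A, f a = c) : ¬ (A.map f).Nodup := by
  classical
  refine not_nodup_map_of_sublist (r := 1) ?_ (List.Sublist.refl A) hA
  refine Finset.card_le_one.2 fun x hx y hy => ?_
  simp only [List.mem_toFinset, List.mem_map] at hx hy
  obtain ⟨a, ha, rfl⟩ := hx
  obtain ⟨b, hb, rfl⟩ := hy
  rw [hc a ha, hc b hb]

lemma coboundary_labelCochain_eq_zero {M : List (ι × ι)} {k : ℕ} (hM : M.length = 2 * k + 2)
    (hk : 1 ≤ k) (h₁ : (M.map Prod.fst).toFinset.card ≤ k + 1)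
    (h₂ : (M.map Prod.snd).toFinset.card ≤ k + 1) :
    coboundary labelCochain M = 0 := by
  have hfst : ∀ A : List (ι × ι), A.Sublist M → k + 2 ≤ A.length → ¬ (A.map Prod.fst).Nodup :=
    fun A hA hl => not_nodup_map_of_sublist h₁ hA hl
  have hsnd : ∀ A : List (ι × ι), A.Sublist M → k + 2 ≤ A.length → ¬ (A.map Prod.snd).Nodup :=
    fun A hA hl => not_nodup_map_of_sublist h₂ hA hl
  have := coboundary_splitSum
    (fun A B => alternatingPair true (A.map (Prod.fst (α := ι))) (B.map (Prod.snd (β := ι)))) M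
  rw [alternatingPair_eq_zero_left _ (hfst M (List.Sublist.refl _) (by omega)),
    alternatingPair_eq_zero_right _ (hsnd M (List.Sublist.refl _) (by omega)),
    add_zero, add_zero] at this
  refine this.trans ((splitSum_congr fun A B hA hB hl _ _ => ?_).trans (splitSum_zero M))
  rw [coboundary_map (fun A' => alternatingPair true A' (B.map Prod.snd)),
    coboundary_map (fun B' => alternatingPair true (A.map Prod.fst) B')]
  rcases (by omega : k + 2 ≤ A.length ∨ k + 2 ≤ B.length) with hl | hl
  · have hA' := hfst A hA hl
    rw [coboundary_eq_zero_of_not_nodup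
      (fun _ _ h => alternatingPair_perm _ h (List.Perm.refl _))
      (fun _ h => alternatingPair_eq_zero_left _ h) hA', zero_add]
    exact (coboundary_congr fun B' _ => alternatingPair_eq_zero_left _ hA').trans
      (coboundary_zero _)
  · have hB' := hsnd B hB hl
    rw [coboundary_eq_zero_of_not_nodup (L := B.map Prod.snd)
      (fun _ _ h => alternatingPair_perm _ (List.Perm.refl _) h)
      (fun _ h => alternatingPair_eq_zero_right _ h) hB', add_zero]
    exact (coboundary_congr fun A' _ => alternatingPair_eq_zero_right _ hB').trans
      (coboundary_zero _)

lemma labelCochain_eq_zero_of_const {M : List (ι × ι)} {k : ℕ} (hk : 1 ≤ k)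
    (hM : M.length = 2 * k + 1)
    (h₁ : (M.map Prod.fst).toFinset.card ≤ k + 1) (h₂ : (M.map Prod.snd).toFinset.card ≤ k + 1)
    (hc : ∃ c, (∀ a ∈ M, a.1 = c) ∨ ∀ a ∈ M, a.2 = c) : labelCochain M = 0 := by
  refine (splitSum_congr fun A B hA hB hl hA₀ hB₀ => ?_).trans (splitSum_zero M)
  have hA₁ := List.length_pos_iff.2 hA₀
  have hB₁ := List.length_pos_iff.2 hB₀
  obtain ⟨c, hc | hc⟩ := hc
  · by_cases h : 2 ≤ A.length
    · exact alternatingPair_eq_zero_left _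
        (not_nodup_map_of_const h fun a ha => hc a (hA.subset ha))
    · exact alternatingPair_eq_zero_right _ (not_nodup_map_of_sublist h₂ hB (by omega))
  · by_cases h : 2 ≤ B.length
    · exact alternatingPair_eq_zero_right _
        (not_nodup_map_of_const h fun a ha => hc a (hB.subset ha))
    · exact alternatingPair_eq_zero_left _ (not_nodup_map_of_sublist h₁ hA (by omega))

end Labels

section Chains

open Finsupp

/-- Mod 2 chains of ordered simplices with vertices in `X`; the empty list is the augmentation. -/
abbrev Chain (X : Type*) := List X →₀ ZMod 2

variable {X Y : Type*}

/-- The cone over a chain with apex `x`. -/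
noncomputable def cone (x : X) : Chain X →ₗ[ZMod 2] Chain X := lmapDomain _ _ (List.cons x)

/-- The chain map induced by a map of vertices. -/
noncomputable def push (f : X → Y) : Chain X →ₗ[ZMod 2] Chain Y := lmapDomain _ _ (List.map f)

/-- Reversal of the order of the vertices. -/
noncomputable def rev : Chain X →ₗ[ZMod 2] Chain X := lmapDomain _ _ List.reverse

/-- The boundary of a single simplex. -/
noncomputable def simplexBoundary : List X → Chain X
  | [] => 0
  | x :: L => single L 1 + cone x (simplexBoundary L)

/-- The boundary operator on mod 2 chains. -/
noncomputable def boundary : Chain X →ₗ[ZMod 2] Chain X :=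
  linearCombination (ZMod 2) simplexBoundary

/-- Evaluation of a cochain on a chain. -/
noncomputable def eval (f : List X → ZMod 2) : Chain X →ₗ[ZMod 2] ZMod 2 :=
  linearCombination (ZMod 2) f

@[simp] lemma cone_single (x : X) (L : List X) (a : ZMod 2) :
    cone x (single L a) = single (x :: L) a := by simp [cone]

@[simp] lemma push_single (f : X → Y) (L : List X) (a : ZMod 2) :
    push f (single L a) = single (L.map f) a := by simp [push]

@[simp] lemma rev_single (L : List X) (a : ZMod 2) :
    rev (single L a) = single L.reverse a := by simp [rev]

@[simp] lemma boundary_single (L : List X) :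
    boundary (single L 1) = simplexBoundary L := by simp [boundary]

@[simp] lemma eval_single (f : List X → ZMod 2) (L : List X) :
    eval f (single L 1) = f L := by simp [eval]

lemma chain_hom_ext {N : Type*} [AddCommMonoid N] [Module (ZMod 2) N]
    {S T : Chain X →ₗ[ZMod 2] N} (h : ∀ L, S (single L 1) = T (single L 1)) (c : Chain X) :
    S c = T c := by
  have : S = T := Finsupp.lhom_ext' fun L => LinearMap.ext_ring (h L)
  rw [this]

lemma chain_add_self (c : Chain X) : c + c = 0 := by
  ext L
  exact CharTwo.add_self_eq_zero _

lemma sum_range_add_succ (a : ℕ → Chain X) (n : ℕ) :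
    ∑ i ∈ Finset.range n, (a i + a (i + 1)) = a 0 + a n := by
  induction n with
  | zero => simp [chain_add_self]
  | succ n ih =>
    rw [Finset.sum_range_succ, ih]
    linear_combination (norm := module) chain_add_self (a n)

lemma boundary_cone (x : X) (c : Chain X) : boundary (cone x c) = c + cone x (boundary c) :=
  chain_hom_ext (S := boundary ∘ₗ cone x) (T := LinearMap.id + cone x ∘ₗ boundary)
    (fun L => by simp [simplexBoundary]) c

lemma push_cone (f : X → Y) (x : X) (c : Chain X) :
    push f (cone x c) = cone (f x) (push f c) :=
  chain_hom_ext (S := push f ∘ₗ cone x) (T := cone (f x) ∘ₗ push f) (fun L => by simp) c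

lemma boundary_push (f : X → Y) (c : Chain X) : boundary (push f c) = push f (boundary c) :=
  chain_hom_ext (S := boundary ∘ₗ push f) (T := push f ∘ₗ boundary) (fun L => by
    simp only [LinearMap.comp_apply, push_single, boundary_single]
    induction L with
    | nil => simp [simplexBoundary]
    | cons x L ih => simp [simplexBoundary, ih, push_cone]) c

lemma push_push {Z : Type*} (f : X → Y) (g : Y → Z) (c : Chain X) :
    push g (push f c) = push (g ∘ f) c :=
  chain_hom_ext (S := push g ∘ₗ push f) (T := push (g ∘ f)) (fun L => by simp) c

lemma push_rev (f : X → Y) (c : Chain X) : push f (rev c) = rev (push f c) :=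
  chain_hom_ext (S := push f ∘ₗ rev) (T := rev ∘ₗ push f) (fun L => by simp) c

lemma rev_rev (c : Chain X) : rev (rev c) = c :=
  chain_hom_ext (S := rev ∘ₗ rev) (T := LinearMap.id) (fun L => by simp) c

lemma boundary_rev (c : Chain X) : boundary (rev c) = rev (boundary c) := by
  have concat : ∀ (L : List X) (x : X), simplexBoundary (L ++ [x]) =
      single L 1 + lmapDomain (ZMod 2) (ZMod 2) (· ++ [x]) (simplexBoundary L) := by
    intro L x
    induction L with
    | nil => simp [simplexBoundary]
    | cons y L ih =>
      have comm : ∀ c : Chain X, cone y (lmapDomain _ (ZMod 2) (· ++ [x]) c) =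
          lmapDomain _ (ZMod 2) (· ++ [x]) (cone y c) := chain_hom_ext
        (S := cone y ∘ₗ lmapDomain _ (ZMod 2) (· ++ [x]))
        (T := lmapDomain _ (ZMod 2) (· ++ [x]) ∘ₗ cone y) fun L => by simp
      simp only [List.cons_append, simplexBoundary, ih, map_add, comm, cone_single]
      simp only [lmapDomain_apply, mapDomain_single]
      abel
  have comm : ∀ (x : X) (c : Chain X), rev (cone x c) =
      lmapDomain _ (ZMod 2) (· ++ [x]) (rev c) := fun x => chain_hom_ext
    (S := rev ∘ₗ cone x) (T := lmapDomain _ (ZMod 2) (· ++ [x]) ∘ₗ rev) fun L => by simp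
  refine chain_hom_ext (S := boundary ∘ₗ rev) (T := rev ∘ₗ boundary) (fun L => ?_) c
  simp only [LinearMap.comp_apply, rev_single, boundary_single]
  induction L with
  | nil => simp [simplexBoundary]
  | cons x L ih => simp only [List.reverse_cons, concat, ih, simplexBoundary, map_add, comm,
      rev_single]

lemma eval_push (f : List Y → ZMod 2) (g : X → Y) (c : Chain X) :
    eval f (push g c) = eval (fun L => f (L.map g)) c :=
  chain_hom_ext (S := eval f ∘ₗ push g) (T := eval fun L => f (L.map g)) (fun L => by simp) c

lemma eval_boundary (f : List X → ZMod 2) (c : Chain X) :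
    eval f (boundary c) = eval (coboundary f) c := by
  have hc : ∀ (f : List X → ZMod 2) (x : X) (c : Chain X),
      eval f (cone x c) = eval (fun L => f (x :: L)) c := fun f x => chain_hom_ext
    (S := eval f ∘ₗ cone x) (T := eval fun L => f (x :: L)) fun L => by simp
  refine chain_hom_ext (S := eval f ∘ₗ boundary) (T := eval (coboundary f)) (fun L => ?_) c
  simp only [LinearMap.comp_apply, boundary_single, eval_single]
  induction L generalizing f with
  | nil => simp [simplexBoundary, coboundary]
  | cons x L ih => simp [simplexBoundary, coboundary, hc, ih]

lemma eval_congr {f g : List X → ZMod 2} {s : Set (List X)} (h : ∀ L ∈ s, f L = g L)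
    {c : Chain X} (hc : c ∈ supported (ZMod 2) (ZMod 2) s) : eval f c = eval g c := by
  rw [eval, eval, linearCombination_apply, linearCombination_apply]
  exact Finsupp.sum_congr fun L hL => by rw [h L (hc hL)]

lemma map_mem_supported {T : Chain X →ₗ[ZMod 2] Chain Y} {s : Set (List X)} {t : Set (List Y)}
    (h : ∀ L ∈ s, T (single L 1) ∈ supported (ZMod 2) (ZMod 2) t) {c : Chain X}
    (hc : c ∈ supported (ZMod 2) (ZMod 2) s) : T c ∈ supported (ZMod 2) (ZMod 2) t := by
  have : supported (ZMod 2) (ZMod 2) s ≤ (supported (ZMod 2) (ZMod 2) t).comap T := by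
    rw [supported_eq_span_single, Submodule.span_le]
    rintro _ ⟨L, hL, rfl⟩
    exact h L hL
  exact this hc

/-- The prism operator between the chain maps induced by `f` and `g`, on a simplex. -/
noncomputable def simplexPrism (f g : X → Y) : List X → Chain Y
  | [] => 0
  | x :: L => single (f x :: g x :: L.map g) 1 + cone (f x) (simplexPrism f g L)

/-- The prism operator, a chain homotopy between the chain maps induced by `f` and `g`. -/
noncomputable def prism (f g : X → Y) : Chain X →ₗ[ZMod 2] Chain Y :=
  linearCombination (ZMod 2) (simplexPrism f g)

@[simp] lemma prism_single (f g : X → Y) (L : List X) :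
    prism f g (single L 1) = simplexPrism f g L := by simp [prism]

lemma prism_cone (f g : X → Y) (x : X) (c : Chain X) : prism f g (cone x c) =
    cone (f x) (cone (g x) (push g c)) + cone (f x) (prism f g c) :=
  chain_hom_ext (S := prism f g ∘ₗ cone x)
    (T := cone (f x) ∘ₗ cone (g x) ∘ₗ push g + cone (f x) ∘ₗ prism f g)
    (fun L => by simp [simplexPrism]) c

lemma boundary_prism (f g : X → Y) (c : Chain X) :
    boundary (prism f g c) + prism f g (boundary c) = push f c + push g c := by
  refine chain_hom_ext (S := boundary ∘ₗ prism f g + prism f g ∘ₗ boundary)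
    (T := push f + push g) (fun L => ?_) c
  simp only [LinearMap.add_apply, LinearMap.comp_apply, boundary_single, prism_single, push_single]
  induction L with
  | nil => simp [simplexPrism, simplexBoundary, chain_add_self]
  | cons x L ih =>
    have hb : simplexBoundary (L.map g) = push g (simplexBoundary L) := by
      rw [← boundary_single, ← push_single, boundary_push, boundary_single]
    have ih' := congrArg (cone (f x)) ih
    simp only [map_add, cone_single] at ih'
    simp only [simplexPrism, simplexBoundary, map_add, boundary_cone, boundary_single,
      prism_single, prism_cone, hb, cone_single, List.map_cons]
    have e₁ := chain_add_self (simplexPrism f g L)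
    have e₂ := chain_add_self (cone (f x) (cone (g x) (push g (simplexBoundary L))))
    have e₃ := chain_add_self (single (f x :: L.map g) (1 : ZMod 2))
    linear_combination (norm := module) ih' + e₁ + e₂ + e₃

lemma simplexPrism_mem (f g : X → Y) (L : List X) :
    simplexPrism f g L ∈ supported (ZMod 2) (ZMod 2)
      {M | M.length = L.length + 1 ∧ ∀ y ∈ M, ∃ x ∈ L, y = f x ∨ y = g x} := by
  induction L with
  | nil => exact Submodule.zero_mem _
  | cons x L ih =>
    refine Submodule.add_mem _ (single_mem_supported _ _ ?_) (map_mem_supported ?_ ih)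
    · refine ⟨by simp, fun y hy => ?_⟩
      simp only [List.mem_cons, List.mem_map] at hy
      rcases hy with rfl | rfl | ⟨z, hz, rfl⟩
      · exact ⟨x, by simp, Or.inl rfl⟩
      · exact ⟨x, by simp, Or.inr rfl⟩
      · exact ⟨z, by simp [hz], Or.inr rfl⟩
    · rintro M ⟨hM, hM'⟩
      rw [cone_single]
      refine single_mem_supported _ _ ⟨by simp [hM], fun y hy => ?_⟩
      rcases List.mem_cons.1 hy with rfl | hy
      · exact ⟨x, by simp, Or.inl rfl⟩
      · obtain ⟨z, hz, h⟩ := hM' y hy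
        exact ⟨z, by simp [hz], h⟩

end Chains

section Homotopy

open Finsupp

variable {X Y : Type*} [PseudoMetricSpace X] [PseudoMetricSpace Y]

/-- The simplices with `n` vertices in `K` whose vertices have mutual distance less than `δ`. -/
def smallSimplices (K : Set X) (δ : ℝ) (n : ℕ) : Set (List X) :=
  {L | L.length = n ∧ ∀ x ∈ L, x ∈ K ∧ ∀ y ∈ L, dist x y < δ}

/-- A homotopy induces a chain homotopy which preserves smallness. -/
lemma exists_chain_homotopy {K : Set X} {K' : Set Y} (hK : IsCompact K) {H : ℝ → X → Y}
    (hH : ContinuousOn (fun p : ℝ × X => H p.1 p.2) (Set.Icc 0 1 ×ˢ K))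
    (hm : ∀ t ∈ Set.Icc (0 : ℝ) 1, ∀ x ∈ K, H t x ∈ K') {δ : ℝ} (hδ : 0 < δ) :
    ∃ δ' > 0, ∃ D : Chain X →ₗ[ZMod 2] Chain Y,
      (∀ c, boundary (D c) + D (boundary c) = push (H 0) c + push (H 1) c) ∧
      (∀ n, ∀ c ∈ supported (ZMod 2) (ZMod 2) (smallSimplices K δ' n),
        D c ∈ supported (ZMod 2) (ZMod 2) (smallSimplices K' δ (n + 1))) ∧
      ∀ n, ∀ L ∈ smallSimplices K δ' n, L.map (H 1) ∈ smallSimplices K' δ n := by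
  have huc := (isCompact_Icc.prod hK).uniformContinuousOn_of_continuous hH
  obtain ⟨δ', hδ', huc⟩ := Metric.uniformContinuousOn_iff.1 huc δ hδ
  obtain ⟨N, hN⟩ := exists_nat_one_div_lt hδ'
  have hN0 : (0 : ℝ) < N + 1 := by positivity
  let τ : ℕ → ℝ := fun i => i / (N + 1)
  have hτ : ∀ i ≤ N + 1, τ i ∈ Set.Icc (0 : ℝ) 1 := fun i hi =>
    ⟨by positivity, (div_le_one hN0).2 (by exact_mod_cast hi)⟩
  have hstep : ∀ i, dist (τ i) (τ (i + 1)) < δ' := fun i => by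
    have : τ i - τ (i + 1) = -(1 / (N + 1)) := by
      simp only [τ]; push_cast; ring
    rw [Real.dist_eq, this, abs_neg, abs_of_pos (by positivity)]
    exact hN
  refine ⟨δ', hδ', ∑ i ∈ Finset.range (N + 1), prism (H (τ i)) (H (τ (i + 1))), fun c => ?_,
    fun n c hc => ?_, fun n L hL => ⟨by simp [hL.1], fun y hy => ?_⟩⟩
  · rw [LinearMap.sum_apply, LinearMap.sum_apply, map_sum, ← Finset.sum_add_distrib]
    simp only [boundary_prism]
    rw [sum_range_add_succ fun i => push (H (τ i)) c]
    have h0 : τ 0 = 0 := by simp [τ]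
    have h1 : τ (N + 1) = 1 := by simp only [τ]; push_cast; exact div_self hN0.ne'
    rw [h0, h1]
  · rw [LinearMap.sum_apply]
    refine Submodule.sum_mem _ fun i hi => map_mem_supported (fun L hL => ?_) hc
    have hi' := Finset.mem_range.1 hi
    rw [prism_single]
    refine supported_mono ?_ (simplexPrism_mem _ _ L)
    rintro M ⟨hM, hM'⟩
    refine ⟨by rw [hM, hL.1], fun y hy => ?_⟩
    have key : ∀ y ∈ M, ∃ x ∈ L, ∃ t, (t = τ i ∨ t = τ (i + 1)) ∧ y = H t x := fun y hy => by
      obtain ⟨x, hx, h | h⟩ := hM' y hy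
      · exact ⟨x, hx, _, Or.inl rfl, h⟩
      · exact ⟨x, hx, _, Or.inr rfl, h⟩
    have hmem : ∀ t, (t = τ i ∨ t = τ (i + 1)) → t ∈ Set.Icc (0 : ℝ) 1 := by
      rintro t (rfl | rfl)
      · exact hτ _ (by omega)
      · exact hτ _ (by omega)
    obtain ⟨x, hx, t, ht, rfl⟩ := key y hy
    refine ⟨hm _ (hmem t ht) _ (hL.2 x hx).1, fun y' hy' => ?_⟩
    obtain ⟨x', hx', t', ht', rfl⟩ := key y' hy'
    refine huc (t, x) ⟨hmem t ht, (hL.2 x hx).1⟩ (t', x') ⟨hmem t' ht', (hL.2 x' hx').1⟩ ?_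
    rw [Prod.dist_eq]
    refine max_lt ?_ ((hL.2 x hx).2 x' hx')
    rcases ht with rfl | rfl <;> rcases ht' with rfl | rfl
    · simpa using hδ'
    · exact hstep i
    · rw [dist_comm]; exact hstep i
    · simpa using hδ'
  · obtain ⟨x, hx, rfl⟩ := List.mem_map.1 hy
    refine ⟨hm _ (by simp) _ (hL.2 x hx).1, fun y' hy' => ?_⟩
    obtain ⟨x', hx', rfl⟩ := List.mem_map.1 hy'
    refine huc (1, x) ⟨by simp, (hL.2 x hx).1⟩ (1, x') ⟨by simp, (hL.2 x' hx').1⟩ ?_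
    simpa [Prod.dist_eq, hδ'] using (hL.2 x hx).2 x' hx'

end Homotopy

section Antipode

open Finsupp

lemma eval_add_left {X : Type*} (f g : List X → ZMod 2) (c : Chain X) :
    eval (fun L => f L + g L) c = eval f c + eval g c :=
  chain_hom_ext (S := eval fun L => f L + g L) (T := eval f + eval g) (fun L => by simp) c

lemma smallSimplices_mono {X : Type*} [PseudoMetricSpace X] {K K' : Set X} {δ δ' : ℝ}
    (hK : K ⊆ K') (hδ : δ ≤ δ') (n : ℕ) : smallSimplices K δ n ⊆ smallSimplices K' δ' n :=
  fun _ hL => ⟨hL.1, fun x hx => ⟨hK (hL.2 x hx).1, fun y hy => ((hL.2 x hx).2 y hy).trans_le hδ⟩⟩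

variable {E : Type*} [NormedAddCommGroup E]

/-- The antipodal involution on chains, which also reverses the order of the vertices. -/
noncomputable def antipode : Chain E →ₗ[ZMod 2] Chain E := rev ∘ₗ push Neg.neg

@[simp] lemma antipode_single (L : List E) (a : ZMod 2) :
    antipode (single L a) = single (L.map Neg.neg).reverse a := by simp [antipode]

lemma antipode_antipode (c : Chain E) : antipode (antipode c) = c := by
  simp only [antipode, LinearMap.comp_apply, push_rev, rev_rev, push_push]
  exact chain_hom_ext (S := push (Neg.neg ∘ Neg.neg)) (T := LinearMap.id) (fun L => by simp) c

lemma boundary_antipode (c : Chain E) : boundary (antipode c) = antipode (boundary c) := by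
  simp only [antipode, LinearMap.comp_apply, boundary_rev, boundary_push]

lemma antipode_mem {K : Set E} (hK : ∀ x ∈ K, -x ∈ K) {δ : ℝ} {n : ℕ} {c : Chain E}
    (hc : c ∈ supported (ZMod 2) (ZMod 2) (smallSimplices K δ n)) :
    antipode c ∈ supported (ZMod 2) (ZMod 2) (smallSimplices K δ n) := by
  refine map_mem_supported (fun L hL => ?_) hc
  rw [antipode_single]
  refine single_mem_supported _ _ ⟨by simp [hL.1], fun x hx => ?_⟩
  simp only [List.mem_reverse, List.mem_map] at hx
  obtain ⟨x, hx, rfl⟩ := hx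
  refine ⟨hK x (hL.2 x hx).1, fun y hy => ?_⟩
  simp only [List.mem_reverse, List.mem_map] at hy
  obtain ⟨y, hy, rfl⟩ := hy
  rw [dist_neg_neg]
  exact (hL.2 x hx).2 y hy

/-- The cochain on the sphere obtained by labelling each vertex together with its antipode. -/
def antipodalCochain {ι : Type*} [LinearOrder ι] (lab : E → ι) (L : List E) : ZMod 2 :=
  labelCochain (L.map fun x => (lab x, lab (-x)))

lemma eval_add_antipode {ι : Type*} [LinearOrder ι] (lab : E → ι) (c : Chain E) :
    eval (antipodalCochain lab) (c + antipode c) =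
      eval (fun L => antipodalCochain lab L +
        labelCochain ((L.map fun x => (lab x, lab (-x))).map Prod.swap).reverse) c := by
  rw [map_add, eval_add_left]
  congr 1
  refine chain_hom_ext (S := eval (antipodalCochain lab) ∘ₗ antipode)
    (T := eval fun L => labelCochain ((L.map fun x => (lab x, lab (-x))).map Prod.swap).reverse)
    (fun L => ?_) c
  simp only [LinearMap.comp_apply, antipode_single, eval_single, antipodalCochain,
    List.map_reverse, List.map_map]
  congr 3
  ext x <;> simp

/-- The points of the unit sphere whose coordinates of index greater than `j` vanish. -/
def subsphere (d j : ℕ) : Set (EuclideanSpace ℝ (Fin d)) :=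
  {x | x ∈ Metric.sphere 0 1 ∧ ∀ i : Fin d, j < i → x i = 0}

lemma isCompact_subsphere (d j : ℕ) : IsCompact (subsphere d j) := by
  have h : subsphere d j = Metric.sphere 0 1 ∩ ⋂ i : Fin d, ⋂ _ : j < i, {x | x i = 0} := by
    ext x
    simp [subsphere]
  rw [h]
  refine (isCompact_sphere _ _).inter_right (isClosed_iInter fun i => isClosed_iInter fun _ => ?_)
  exact isClosed_eq (by fun_prop) continuous_const

lemma neg_mem_subsphere {d j : ℕ} {x : EuclideanSpace ℝ (Fin d)} (hx : x ∈ subsphere d j) :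
    -x ∈ subsphere d j :=
  ⟨by simpa using hx.1, fun i hi => by simp [hx.2 i hi]⟩

lemma single_mem_subsphere {d j : ℕ} (hj : j < d) :
    EuclideanSpace.single (⟨j, hj⟩ : Fin d) (1 : ℝ) ∈ subsphere d j :=
  ⟨by simp, fun i hi => by
    have : i ≠ ⟨j, hj⟩ := fun h => by simp [h] at hi
    simp [this]⟩

lemma cos_smul_add_sin_smul_mem {d j : ℕ} (hj : j + 1 < d) (θ : ℝ)
    {x : EuclideanSpace ℝ (Fin d)} (hx : x ∈ subsphere d j) :
    Real.cos θ • x + Real.sin θ • EuclideanSpace.single (⟨j + 1, hj⟩ : Fin d) (1 : ℝ) ∈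
      subsphere d (j + 1) := by
  have hx1 : ‖x‖ = 1 := by simpa using hx.1
  refine ⟨?_, fun i hi => ?_⟩
  · rw [mem_sphere_zero_iff_norm, ← sq_eq_sq₀ (norm_nonneg _) zero_le_one, norm_add_sq_real,
      norm_smul, norm_smul, inner_smul_left, inner_smul_right, hx1]
    simp only [EuclideanSpace.inner_single_right, hx.2 ⟨j + 1, hj⟩ (Nat.lt_succ_self j)]
    simp
  · have : i ≠ ⟨j + 1, hj⟩ := fun h => by simp [h] at hi
    simp [this, hx.2 i (by omega)]

/-- The antipodal labelling cochain detects the antipodally symmetric spheres. -/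
lemma exists_symmetric_cycle {d : ℕ} {ι : Type*} [LinearOrder ι]
    (lab : EuclideanSpace ℝ (Fin d) → ι) {η : ℝ} (hη : 0 < η)
    (hlab : ∀ x ∈ Metric.sphere (0 : EuclideanSpace ℝ (Fin d)) 1,
      ∀ y ∈ Metric.sphere (0 : EuclideanSpace ℝ (Fin d)) 1, dist x y < η → lab x ≠ lab (-y))
    (j : ℕ) (hj : j < d) {δ : ℝ} (hδ : 0 < δ) :
    ∃ z ∈ supported (ZMod 2) (ZMod 2) (smallSimplices (subsphere d j) δ (j + 1)),
      antipode z = z ∧ boundary z = 0 ∧ eval (antipodalCochain lab) z = 1 := by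
  have symm : ∀ c : Chain (EuclideanSpace ℝ (Fin d)), antipode (c + antipode c) =
      c + antipode c := fun c => by rw [map_add, antipode_antipode, add_comm]
  induction j generalizing δ with
  | zero =>
    set e := EuclideanSpace.single (⟨0, hj⟩ : Fin d) (1 : ℝ) with he
    have hemem := single_mem_subsphere hj
    rw [← he] at hemem
    have hc : single [e] 1 ∈ supported (ZMod 2) (ZMod 2)
        (smallSimplices (subsphere d 0) δ (0 + 1)) :=
      single_mem_supported _ _ ⟨rfl, by simpa using ⟨hemem, hδ⟩⟩
    refine ⟨_, Submodule.add_mem _ hc (antipode_mem (fun x => neg_mem_subsphere) hc), symm _,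
      ?_, ?_⟩
    · simp [simplexBoundary, chain_add_self]
    · rw [eval_add_antipode, eval_single]
      exact labelCochain_singleton (hlab e hemem.1 e hemem.1 (by simpa using hη))
  | succ j ih =>
    set e := EuclideanSpace.single (⟨j + 1, hj⟩ : Fin d) (1 : ℝ) with he
    have hemem := single_mem_subsphere hj
    rw [← he] at hemem
    let H : ℝ → EuclideanSpace ℝ (Fin d) → EuclideanSpace ℝ (Fin d) := fun t x =>
      Real.cos (Real.pi / 2 * t) • x + Real.sin (Real.pi / 2 * t) • e
    have hδη : 0 < min δ η := lt_min hδ hη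
    obtain ⟨δ', hδ', D, hD, hDmem, -⟩ := exists_chain_homotopy (isCompact_subsphere d j)
      (K' := subsphere d (j + 1)) (H := H) (by fun_prop)
      (fun t _ x hx => cos_smul_add_sin_smul_mem hj _ hx) hδη
    obtain ⟨z, hz, hzsymm, hzb, hzu⟩ := ih (by omega) hδ'
    have hH0 : push (H 0) z = z := by
      have : H 0 = id := by ext1 x; simp [H]
      rw [this]
      exact chain_hom_ext (S := push id) (T := LinearMap.id) (fun L => by simp) z
    have hH1 : H 1 = fun _ => e := by ext1 x; simp [H]
    set c := D z + cone e (push (H 1) z) with hc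
    have hcb : boundary c = z := by
      have h := hD z
      rw [hzb, map_zero, add_zero, hH0] at h
      rw [hc, map_add, boundary_cone, boundary_push, hzb, map_zero, map_zero, h]
      linear_combination (norm := module) chain_add_self (push (H 1) z)
    have hcmem : c ∈ supported (ZMod 2) (ZMod 2)
        (smallSimplices (subsphere d (j + 1)) (min δ η) (j + 1 + 1)) := by
      refine Submodule.add_mem _ (hDmem _ _ hz) (map_mem_supported
        (T := cone e ∘ₗ push (H 1)) (fun L hL => ?_) hz)
      rw [LinearMap.comp_apply, push_single, cone_single, hH1, List.map_const', hL.1,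
        ← List.replicate_succ]
      refine single_mem_supported _ _ ⟨by simp, fun x hx => ?_⟩
      rw [List.eq_of_mem_replicate hx]
      refine ⟨hemem, fun y hy => ?_⟩
      rw [List.eq_of_mem_replicate hy, dist_self]
      exact hδη
    have hcmem' := supported_mono (M := ZMod 2) (R := ZMod 2)
      (smallSimplices_mono (subset_refl (subsphere d (j + 1))) (min_le_left δ η) _) hcmem
    refine ⟨_, Submodule.add_mem _ hcmem' (antipode_mem (fun x => neg_mem_subsphere) hcmem'),
      symm _, ?_, ?_⟩
    · rw [map_add, boundary_antipode, hcb, hzsymm, chain_add_self]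
    · rw [eval_add_antipode, ← hzu, ← hcb, eval_boundary]
      refine eval_congr (fun L hL => ?_) hcmem
      unfold antipodalCochain
      rw [coboundary_map, coboundary_labelCochain]
      · intro a ha b hb
        obtain ⟨x, hx, rfl⟩ := List.mem_map.1 ha
        obtain ⟨y, hy, rfl⟩ := List.mem_map.1 hb
        exact hlab x (hL.2 x hx).1.1 y (hL.2 y hy).1.1
          (((hL.2 x hx).2 y hy).trans_le (min_le_right _ _))
      · rw [List.length_map, hL.1]
        omega

end Antipode

section Boost

variable {E : Type*} [NormedAddCommGroup E] [InnerProductSpace ℝ E]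

/-- The conformal automorphism of the unit sphere which pushes every point towards `p`, with
speed `v`. -/
noncomputable def boost (p : E) (v : ℝ) (x : E) : E :=
  (1 + v * inner ℝ p x)⁻¹ • (√(1 - v ^ 2) • (x - inner ℝ p x • p) + (inner ℝ p x + v) • p)

lemma boost_zero (p x : E) : boost p 0 x = x := by simp [boost]

lemma abs_inner_le_one {p x : E} (hp : ‖p‖ = 1) (hx : ‖x‖ = 1) : |inner ℝ p x| ≤ 1 := by
  simpa [hp, hx] using abs_real_inner_le_norm p x

lemma boost_denom_pos {p x : E} (hp : ‖p‖ = 1) (hx : ‖x‖ = 1) {v : ℝ} (hv0 : 0 ≤ v)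
    (hv : v < 1) : 0 < 1 + v * inner ℝ p x := by
  have := (abs_le.1 (abs_inner_le_one hp hx)).1
  nlinarith

lemma norm_boost {p x : E} (hp : ‖p‖ = 1) (hx : ‖x‖ = 1) {v : ℝ} (hv0 : 0 ≤ v) (hv : v < 1) :
    ‖boost p v x‖ = 1 := by
  have hd := boost_denom_pos hp hx hv0 hv
  have hpp : inner ℝ p p = (1 : ℝ) := by simp [hp]
  have hxx : inner ℝ x x = (1 : ℝ) := by simp [hx]
  have hs : √(1 - v ^ 2) ^ 2 = 1 - v ^ 2 := Real.sq_sqrt (by nlinarith)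
  rw [← sq_eq_sq₀ (norm_nonneg _) zero_le_one, boost, norm_smul, mul_pow,
    ← real_inner_self_eq_norm_sq (√(1 - v ^ 2) • (x - inner ℝ p x • p) + (inner ℝ p x + v) • p)]
  simp only [inner_add_left, inner_add_right, inner_sub_left, inner_sub_right,
    real_inner_smul_left, real_inner_smul_right, hpp, hxx, real_inner_comm p x]
  rw [Real.norm_of_nonneg (inv_pos.2 hd).le, inv_pow, inv_mul_eq_iff_eq_mul₀ (by positivity)]
  linear_combination (1 - (inner ℝ p x) ^ 2) * hs

lemma dist_boost_sq_le {p x : E} (hp : ‖p‖ = 1) (hx : ‖x‖ = 1) {v : ℝ} (hv0 : 0 ≤ v)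
    (hv : v < 1) (hpx : 0 ≤ inner ℝ p x) : dist (boost p v x) p ^ 2 ≤ 2 * (1 - v) := by
  have hd := boost_denom_pos hp hx hv0 hv
  have hpp : inner ℝ p p = (1 : ℝ) := by simp [hp]
  have hb : inner ℝ (boost p v x) p = (1 + v * inner ℝ p x)⁻¹ * (inner ℝ p x + v) := by
    simp only [boost, inner_add_left, inner_sub_left, real_inner_smul_left, hpp,
      real_inner_comm p x]
    ring
  have hv' : v ≤ inner ℝ (boost p v x) p := by
    rw [hb, le_inv_mul_iff₀ hd]
    nlinarith [mul_nonneg hpx (show 0 ≤ 1 - v ^ 2 by nlinarith)]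
  rw [dist_eq_norm, norm_sub_sq_real, norm_boost hp hx hv0 hv, hp]
  linarith

lemma continuousOn_boost {p : E} (hp : ‖p‖ = 1) :
    ContinuousOn (fun q : ℝ × E => boost p q.1 q.2) (Set.Ico 0 1 ×ˢ Metric.sphere 0 1) := by
  unfold boost
  refine ContinuousOn.smul (ContinuousOn.inv₀ (by fun_prop) fun q hq => ?_) (by fun_prop)
  exact (boost_denom_pos hp (by simpa using hq.2) hq.1.1 hq.1.2).ne'

end Boost

section LowerBound

open Finsupp

/-- On an even-dimensional sphere an antipodal labelling uses at least `m + 2` labels on some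
set of diameter at most `η`. -/
lemma exists_small_card_lt {m : ℕ} (hm : 1 ≤ m) {ι : Type*} [LinearOrder ι]
    (lab : EuclideanSpace ℝ (Fin (2 * m + 1)) → ι) {η : ℝ} (hη : 0 < η)
    (hlab : ∀ x ∈ Metric.sphere (0 : EuclideanSpace ℝ (Fin (2 * m + 1))) 1,
      ∀ y ∈ Metric.sphere (0 : EuclideanSpace ℝ (Fin (2 * m + 1))) 1,
        dist x y < η → lab x ≠ lab (-y))
    {p : EuclideanSpace ℝ (Fin (2 * m + 1))} (hp : ‖p‖ = 1)
    (hlabp : ∀ x ∈ Metric.sphere (0 : EuclideanSpace ℝ (Fin (2 * m + 1))) 1,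
      dist x p < η → lab x = lab p) :
    ∃ L : List (EuclideanSpace ℝ (Fin (2 * m + 1))),
      (∀ x ∈ L, x ∈ Metric.sphere 0 1 ∧ ∀ y ∈ L, dist x y < η) ∧
        m + 1 < (L.map lab).toFinset.card := by
  by_contra! hcard
  set S := Metric.sphere (0 : EuclideanSpace ℝ (Fin (2 * m + 1))) 1 with hS
  have hnorm : ∀ {x}, x ∈ S → ‖x‖ = 1 := fun hx => by simpa [hS] using hx
  have hneg : ∀ {x}, x ∈ S → -x ∈ S := fun hx => by simpa [hS] using hx
  obtain ⟨v, hv0, hv1, hvη⟩ : ∃ v : ℝ, 0 ≤ v ∧ v < 1 ∧ 2 * (1 - v) < (η / 2) ^ 2 := by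
    refine ⟨1 - min (1 / 2) (η ^ 2 / 16), ?_, ?_, ?_⟩
    · linarith [min_le_left (1 / 2) (η ^ 2 / 16)]
    · linarith [lt_min (show (0 : ℝ) < 1 / 2 by norm_num) (show 0 < η ^ 2 / 16 by positivity)]
    · nlinarith [min_le_right (1 / 2) (η ^ 2 / 16)]
  have hball : ∀ x ∈ S, 0 ≤ inner ℝ p x → dist (boost p v x) p < η / 2 := fun x hx h =>
    lt_of_pow_lt_pow_left₀ 2 (by positivity)
      ((dist_boost_sq_le hp (hnorm hx) hv0 hv1 h).trans_lt hvη)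
  have htv : ∀ t ∈ Set.Icc (0 : ℝ) 1, t * v ∈ Set.Ico (0 : ℝ) 1 := fun t ht =>
    ⟨mul_nonneg ht.1 hv0, by nlinarith [ht.1, ht.2]⟩
  have hmem : ∀ t ∈ Set.Icc (0 : ℝ) 1, ∀ x ∈ S, boost p (t * v) x ∈ S := fun t ht x hx => by
    simpa [hS] using norm_boost hp (hnorm hx) (htv t ht).1 (htv t ht).2
  let H : ℝ → EuclideanSpace ℝ (Fin (2 * m + 1)) →
      EuclideanSpace ℝ (Fin (2 * m + 1)) × EuclideanSpace ℝ (Fin (2 * m + 1)) :=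
    fun t x => (boost p (t * v) x, boost p (t * v) (-x))
  have hH : ContinuousOn (fun q : ℝ × EuclideanSpace ℝ (Fin (2 * m + 1)) => H q.1 q.2)
      (Set.Icc 0 1 ×ˢ S) := by
    refine ContinuousOn.prodMk ?_ ?_
    · exact (continuousOn_boost hp).comp
        (f := fun q : ℝ × EuclideanSpace ℝ (Fin (2 * m + 1)) => (q.1 * v, q.2)) (by fun_prop)
        fun q hq => ⟨htv _ hq.1, hq.2⟩
    · exact (continuousOn_boost hp).comp
        (f := fun q : ℝ × EuclideanSpace ℝ (Fin (2 * m + 1)) => (q.1 * v, -q.2)) (by fun_prop)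
        fun q hq => ⟨htv _ hq.1, hneg hq.2⟩
  obtain ⟨δ, hδ, D, hD, hDmem, hDmap⟩ := exists_chain_homotopy (isCompact_sphere _ _)
    (K' := S ×ˢ S) hH (fun t ht x hx => ⟨hmem t ht x hx, hmem t ht _ (hneg hx)⟩)
    (half_pos hη)
  obtain ⟨z, hz, -, hzb, hzu⟩ := exists_symmetric_cycle lab hη hlab (2 * m) (by omega) hδ
  replace hz := supported_mono (M := ZMod 2) (R := ZMod 2)
    (smallSimplices_mono (K' := S) (fun x hx => hx.1) le_rfl _) hz
  let V : List (EuclideanSpace ℝ (Fin (2 * m + 1)) × EuclideanSpace ℝ (Fin (2 * m + 1))) →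
    ZMod 2 := fun L => labelCochain (L.map (Prod.map lab lab))
  have hfst : ∀ n, ∀ M ∈ smallSimplices (S ×ˢ S) (η / 2) n,
      ((M.map (Prod.map lab lab)).map Prod.fst).toFinset.card ≤ m + 1 := fun n M hM => by
    have := hcard (M.map Prod.fst) fun x hx => by
      obtain ⟨a, ha, rfl⟩ := List.mem_map.1 hx
      refine ⟨(hM.2 a ha).1.1, fun y hy => ?_⟩
      obtain ⟨b, hb, rfl⟩ := List.mem_map.1 hy
      have := (le_max_left _ _).trans_lt ((hM.2 a ha).2 b hb)
      linarith
    simpa [List.map_map, Function.comp_def] using this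
  have hsnd : ∀ n, ∀ M ∈ smallSimplices (S ×ˢ S) (η / 2) n,
      ((M.map (Prod.map lab lab)).map Prod.snd).toFinset.card ≤ m + 1 := fun n M hM => by
    have := hcard (M.map Prod.snd) fun x hx => by
      obtain ⟨a, ha, rfl⟩ := List.mem_map.1 hx
      refine ⟨(hM.2 a ha).1.2, fun y hy => ?_⟩
      obtain ⟨b, hb, rfl⟩ := List.mem_map.1 hy
      have := (le_max_right _ _).trans_lt ((hM.2 a ha).2 b hb)
      linarith
    simpa [List.map_map, Function.comp_def] using this
  have hzero : eval V (push (H 0) z) = 1 := by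
    rw [← hzu, eval_push]
    congr 2
    ext1 L
    simp only [V, antipodalCochain, List.map_map]
    congr 2
    ext1 x
    simp [H, boost_zero]
  have hDz : eval V (boundary (D z)) = 0 := by
    rw [eval_boundary, eval_congr (g := fun _ => 0) (fun M hM => ?_) (hDmem _ _ hz)]
    · simp [eval, linearCombination_apply]
    · rw [coboundary_map]
      exact coboundary_labelCochain_eq_zero (by rw [List.length_map, hM.1]) hm
        (hfst _ M hM) (hsnd _ M hM)
  have hone : eval V (push (H 1) z) = 0 := by
    rw [eval_push, eval_congr (g := fun _ => 0) (fun L hL => ?_) hz]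
    · simp [eval, linearCombination_apply]
    · have hM := hDmap _ L hL
      have hLlen := hL.1
      refine labelCochain_eq_zero_of_const hm (by simp [hLlen]) (hfst _ _ hM) (hsnd _ _ hM)
        ⟨lab p, ?_⟩
      obtain ⟨x, hx⟩ := List.exists_mem_of_length_pos (l := L) (by omega)
      have hxS := (hL.2 x hx).1
      have hxM : H 1 x ∈ L.map (H 1) := List.mem_map_of_mem hx
      rcases le_total 0 (inner ℝ p x) with h | h
      · refine Or.inl fun a ha => ?_
        obtain ⟨b, hb, rfl⟩ := List.mem_map.1 ha
        refine hlabp _ (hM.2 b hb).1.1 ?_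
        have h1 := (le_max_left _ _).trans_lt ((hM.2 b hb).2 _ hxM)
        have h2 := hball x hxS h
        simp only [H, one_mul] at h1
        linarith [dist_triangle b.1 (boost p v x) p]
      · refine Or.inr fun a ha => ?_
        obtain ⟨b, hb, rfl⟩ := List.mem_map.1 ha
        refine hlabp _ (hM.2 b hb).1.2 ?_
        have h1 := (le_max_right _ _).trans_lt ((hM.2 b hb).2 _ hxM)
        have h2 := hball (-x) (hneg hxS) (by simpa [inner_neg_right] using h)
        simp only [H, one_mul] at h1
        linarith [dist_triangle b.2 (boost p v (-x)) p]
  have key := congrArg (eval V) (hD z)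
  rw [hzb, map_zero, add_zero, map_add, hDz, hzero, hone] at key
  simp at key

end LowerBound

section Covers

variable {m : ℕ}

/-- Every antipode-free open cover of an even-dimensional sphere has a point of large
multiplicity. -/
lemma exists_lt_ncard (hm : 1 ≤ m) {n : ℕ}
    {U : Fin n → Set (EuclideanSpace ℝ (Fin (2 * m + 1)))}
    (hopen : ∀ i, ∃ V, IsOpen V ∧ U i = V ∩ Metric.sphere 0 1)
    (hcover : Metric.sphere (0 : EuclideanSpace ℝ (Fin (2 * m + 1))) 1 ⊆ ⋃ i, U i)
    (hanti : ∀ i, ∀ x, x ∈ U i → -x ∉ U i) :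
    ∃ x ∈ Metric.sphere (0 : EuclideanSpace ℝ (Fin (2 * m + 1))) 1,
      m + 1 < {i : Fin n | x ∈ U i}.ncard := by
  choose V hV hUV using hopen
  set S := Metric.sphere (0 : EuclideanSpace ℝ (Fin (2 * m + 1))) 1 with hS
  obtain ⟨ε, hε, hball⟩ := lebesgue_number_lemma_of_metric
    (isCompact_sphere (0 : EuclideanSpace ℝ (Fin (2 * m + 1))) 1) hV
    (hcover.trans (Set.iUnion_mono fun i => by rw [hUV i]; exact Set.inter_subset_left))
  set p := EuclideanSpace.single (0 : Fin (2 * m + 1)) (1 : ℝ) with hp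
  have hp1 : ‖p‖ = 1 := by simp [hp]
  have hpS : p ∈ S := by simp [hS, hp1]
  have : Nonempty (Fin n) := ⟨(hball p hpS).choose⟩
  choose! f hf using hball
  classical
  let lab : EuclideanSpace ℝ (Fin (2 * m + 1)) → Fin n := fun x =>
    if dist x p < ε / 2 then f p else f x
  have hlab : ∀ x ∈ S, ∀ y ∈ S, dist x y < ε / 2 → y ∈ U (lab x) := fun x hx y hy hxy => by
    rw [hUV]
    refine ⟨?_, hy⟩
    by_cases h : dist x p < ε / 2
    · simp only [lab, if_pos h]
      refine hf p hpS ?_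
      rw [Metric.mem_ball]
      linarith [dist_triangle_left y p x]
    · simp only [lab, if_neg h]
      refine hf x hx ?_
      rw [Metric.mem_ball, dist_comm]
      linarith
  obtain ⟨L, hL, hcard⟩ := exists_small_card_lt hm lab (half_pos hε)
    (fun x hx y hy hxy h => hanti _ y (hlab x hx y hy hxy) (by
      have hy' : -y ∈ S := by simpa [hS] using hy
      rw [h]
      exact hlab _ hy' _ hy' (by simpa using hε)))
    hp1 (fun x _ h => by simp [lab, h])
  obtain ⟨i, hi⟩ := Finset.card_pos.1 (Nat.zero_lt_of_lt hcard)
  obtain ⟨x, hx, -⟩ := List.mem_map.1 (List.mem_toFinset.1 hi)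
  refine ⟨x, (hL x hx).1, hcard.trans_le ?_⟩
  rw [← Set.ncard_coe_finset]
  refine Set.ncard_le_ncard (fun i hi => ?_) (Set.toFinite _)
  obtain ⟨y, hy, rfl⟩ := List.mem_map.1 (List.mem_toFinset.1 hi)
  exact hlab y (hL y hy).1 x (hL x hx).1 ((hL y hy).2 x hx)

/-- The coordinates of a point together with the negative of their sum. -/
noncomputable def balanced (x : EuclideanSpace ℝ (Fin (2 * m + 1))) :
    Option (Fin (2 * m + 1)) → ℝ
  | none => -∑ i, x i
  | some i => x i

lemma sum_balanced (x : EuclideanSpace ℝ (Fin (2 * m + 1))) : ∑ i, balanced x i = 0 := by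
  simp [Fintype.sum_option, balanced]

lemma balanced_neg (x : EuclideanSpace ℝ (Fin (2 * m + 1))) (i : Option (Fin (2 * m + 1))) :
    balanced (-x) i = -balanced x i := by
  cases i <;> simp [balanced]

lemma continuous_balanced (i : Option (Fin (2 * m + 1))) :
    Continuous fun x : EuclideanSpace ℝ (Fin (2 * m + 1)) => balanced x i := by
  cases i <;> simp only [balanced] <;> fun_prop

lemma exists_lt_balanced {x : EuclideanSpace ℝ (Fin (2 * m + 1))} (hx : ‖x‖ = 1) :
    ∃ i, 1 / (2 * m + 2 : ℝ) ^ 2 < balanced x i := by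
  by_contra! h
  set c := 1 / (2 * m + 2 : ℝ) ^ 2 with hc
  have hlower : ∀ i, -((2 * m + 1) * c) ≤ x i := fun i => by
    have h1 := Finset.sum_le_card_nsmul (Finset.univ.erase (some i)) (balanced x) c
      fun j _ => h j
    have h2 := Finset.add_sum_erase Finset.univ (balanced x) (Finset.mem_univ (some i))
    rw [sum_balanced] at h2
    rw [Finset.card_erase_of_mem (Finset.mem_univ _), Finset.card_univ, Fintype.card_option,
      Fintype.card_fin, nsmul_eq_mul] at h1
    push_cast at h1
    have h3 : balanced x (some i) = x i := rfl
    linarith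
  have hc0 : 0 < c := by positivity
  have hsq : ∀ i, x i ^ 2 ≤ ((2 * m + 1) * c) ^ 2 := fun i => by
    have hi := h (some i)
    simp only [balanced] at hi
    refine sq_le_sq' (hlower i) (hi.trans ?_)
    nlinarith [show (0 : ℝ) ≤ m from m.cast_nonneg]
  have hsum : (1 : ℝ) ≤ (2 * m + 1) * ((2 * m + 1) * c) ^ 2 := by
    have h1 := EuclideanSpace.real_norm_sq_eq x
    have h2 := Finset.sum_le_card_nsmul Finset.univ (fun i => x i ^ 2) _ fun i _ => hsq i
    rw [Finset.card_univ, Fintype.card_fin, nsmul_eq_mul] at h2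
    push_cast at h2
    rw [← h1, hx] at h2
    linarith
  have hm0 : (0 : ℝ) ≤ m := m.cast_nonneg
  have hKc : (2 * m + 1) * c < 1 / (2 * m + 2) := by
    rw [hc, mul_one_div, div_lt_div_iff₀ (by positivity) (by positivity)]
    nlinarith
  have hle : (2 * m + 1) * c ≤ 1 := hKc.le.trans ((div_le_one (by positivity)).2 (by linarith))
  have : (2 * m + 1) * ((2 * m + 1) * c) < 1 := by
    calc (2 * m + 1) * ((2 * m + 1) * c) < (2 * m + 1) * (1 / (2 * m + 2)) := by gcongr
      _ ≤ 1 := by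
        rw [mul_one_div, div_le_one (by positivity)]
        linarith
  nlinarith [show 0 ≤ (2 * m + 1) * c by positivity]

/-- The points with many balanced coordinates which are positive. -/
def manyPositive (m : ℕ) : Set (EuclideanSpace ℝ (Fin (2 * m + 1))) :=
  ⋃ T : {T : Finset (Option (Fin (2 * m + 1))) // m + 2 ≤ T.card}, ⋂ i ∈ T.1,
    {x | 0 < balanced x i}

/-- The points with many balanced coordinates which are at least `c`. -/
def manyLarge (m : ℕ) (c : ℝ) : Set (EuclideanSpace ℝ (Fin (2 * m + 1))) :=
  ⋃ T : {T : Finset (Option (Fin (2 * m + 1))) // m + 2 ≤ T.card}, ⋂ i ∈ T.1,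
    {x | c ≤ balanced x i}

lemma isOpen_manyPositive : IsOpen (manyPositive m) :=
  isOpen_iUnion fun _ => isOpen_biInter_finset fun i _ =>
    isOpen_lt continuous_const (continuous_balanced i)

lemma isClosed_manyLarge (c : ℝ) : IsClosed (manyLarge m c) :=
  isClosed_iUnion_of_finite fun _ => isClosed_biInter fun i _ =>
    isClosed_le continuous_const (continuous_balanced i)

lemma manyLarge_subset {c : ℝ} (hc : 0 < c) : manyLarge m c ⊆ manyPositive m :=
  Set.iUnion_mono fun _ => Set.iInter₂_mono fun _ _ _ hx => hc.trans_le hx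

lemma neg_notMem_manyPositive {x : EuclideanSpace ℝ (Fin (2 * m + 1))}
    (hx : x ∈ manyPositive m) : -x ∉ manyPositive m := by
  intro hx'
  simp only [manyPositive, Set.mem_iUnion, Set.mem_iInter, Set.mem_ofPred_eq, balanced_neg]
    at hx hx'
  obtain ⟨⟨T, hT⟩, hxT⟩ := hx
  obtain ⟨⟨T', hT'⟩, hxT'⟩ := hx'
  have hdisj : Disjoint T T' := Finset.disjoint_left.2 fun i hi hi' => by
    linarith [hxT i hi, hxT' i hi']
  have := (Finset.card_union_of_disjoint hdisj).symm.trans_le (Finset.card_le_univ _)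
  rw [Fintype.card_option, Fintype.card_fin] at this
  omega

/-- An antipode-free open cover of an even-dimensional sphere with small multiplicity. -/
def lowMultiplicityCover (m : ℕ) (c : ℝ) :
    Option (Option (Fin (2 * m + 1))) → Set (EuclideanSpace ℝ (Fin (2 * m + 1)))
  | none => manyPositive m
  | some i => {x | c < balanced x i} \ manyLarge m c

lemma isOpen_lowMultiplicityCover (c : ℝ) (i : Option (Option (Fin (2 * m + 1)))) :
    IsOpen (lowMultiplicityCover m c i) := by
  cases i with
  | none => exact isOpen_manyPositive
  | some i =>
    exact (isOpen_lt continuous_const (continuous_balanced i)).sdiff (isClosed_manyLarge c)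

lemma exists_mem_lowMultiplicityCover {x : EuclideanSpace ℝ (Fin (2 * m + 1))}
    (hx : ‖x‖ = 1) : ∃ i, x ∈ lowMultiplicityCover m (1 / (2 * m + 2 : ℝ) ^ 2) i := by
  by_cases h : x ∈ manyLarge m (1 / (2 * m + 2 : ℝ) ^ 2)
  · exact ⟨none, manyLarge_subset (by positivity) h⟩
  · obtain ⟨i, hi⟩ := exists_lt_balanced hx
    exact ⟨some i, hi, h⟩

lemma neg_notMem_lowMultiplicityCover {c : ℝ} (hc : 0 < c)
    {i : Option (Option (Fin (2 * m + 1)))} {x : EuclideanSpace ℝ (Fin (2 * m + 1))}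
    (hx : x ∈ lowMultiplicityCover m c i) : -x ∉ lowMultiplicityCover m c i := by
  cases i with
  | none => exact neg_notMem_manyPositive hx
  | some i =>
    rintro ⟨hx', -⟩
    have h : c < balanced x i := hx.1
    have h' : c < balanced (-x) i := hx'
    rw [balanced_neg] at h'
    linarith

lemma ncard_lowMultiplicityCover_le {c : ℝ} (x : EuclideanSpace ℝ (Fin (2 * m + 1))) :
    {i | x ∈ lowMultiplicityCover m c i}.ncard ≤ m + 2 := by
  classical
  by_cases h : x ∈ manyLarge m c
  · refine (Set.ncard_le_ncard (t := {none}) (fun i hi => ?_) (Set.toFinite _)).trans (by simp)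
    cases i with
    | none => rfl
    | some i => exact absurd h hi.2
  · let T : Finset (Option (Fin (2 * m + 1))) := Finset.univ.filter fun i => c < balanced x i
    have hT : T.card < m + 2 := by
      by_contra! hT
      refine h (Set.mem_iUnion.2 ⟨⟨T, hT⟩, Set.mem_iInter₂.2 fun i hi => ?_⟩)
      exact (Finset.mem_filter.1 hi).2.le
    calc {i | x ∈ lowMultiplicityCover m c i}.ncard
        ≤ (T.insertNone : Set (Option (Option (Fin (2 * m + 1))))).ncard :=
          Set.ncard_le_ncard (fun i hi => by
            cases i with
            | none => simp
            | some i => simpa [T] using hi.1) (Set.toFinite _)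
      _ ≤ m + 2 := by
        rw [Set.ncard_coe_finset, Finset.card_insertNone]
        omega

end Covers

end AntipodalCover

/-- For even `h = 2m ≥ 2`, the minimal `l` such that the sphere `S^h` (unit sphere
in `ℝ^{h+1}`) can be covered by open sets, none containing a pair of antipodal
points, with every point contained in at most `l` of the sets, equals
`h/2 + 2 = m + 2`. -/
theorem Q_even (m : ℕ) (hm : 1 ≤ m) :
    IsLeast {l : ℕ |
      ∃ (n : ℕ) (U : Fin n → Set (EuclideanSpace ℝ (Fin (2 * m + 1)))),
        (∀ i, ∃ V, IsOpen V ∧ U i = V ∩ Metric.sphere 0 1) ∧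
        (Metric.sphere (0 : EuclideanSpace ℝ (Fin (2 * m + 1))) 1 ⊆ ⋃ i, U i) ∧
        (∀ i, ∀ x, x ∈ U i → -x ∉ U i) ∧
        (∀ x ∈ Metric.sphere (0 : EuclideanSpace ℝ (Fin (2 * m + 1))) 1,
          {i : Fin n | x ∈ U i}.ncard ≤ l)} (m + 2) := by
  constructor
  · let c : ℝ := 1 / (2 * m + 2 : ℝ) ^ 2
    have hc : 0 < c := by positivity
    let e := Fintype.equivFin (Option (Option (Fin (2 * m + 1))))
    refine ⟨_, fun k => AntipodalCover.lowMultiplicityCover m c (e.symm k) ∩ Metric.sphere 0 1,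
      fun k => ⟨_, AntipodalCover.isOpen_lowMultiplicityCover c _, rfl⟩, fun x hx => ?_,
      fun k x hx hx' => AntipodalCover.neg_notMem_lowMultiplicityCover hc hx.1 hx'.1,
      fun x hx => ?_⟩
    · obtain ⟨i, hi⟩ := AntipodalCover.exists_mem_lowMultiplicityCover (x := x) (by simpa using hx)
      exact Set.mem_iUnion.2 ⟨e i, by simpa [c] using hi, hx⟩
    · refine le_trans (Set.ncard_le_ncard_of_injOn e.symm (fun k hk => hk.1)
        e.symm.injective.injOn (Set.toFinite _))
        (AntipodalCover.ncard_lowMultiplicityCover_le (c := c) x)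
  · rintro l ⟨n, U, hopen, hcover, hanti, hl⟩
    obtain ⟨x, hx, hlt⟩ := AntipodalCover.exists_lt_ncard hm hopen hcover hanti
    exact hlt.trans_le (hl x hx)
end
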